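/- arXiv:1410.1911 — 4 statements merged into one kernel-verified Lean document; each statement's English description precedes it below -/
import Mathlib

section
/- Let λ ∈ [0,1), μ ∈ ℂ and a > −1. Then the integral ∫_0^∞ x^a · M_{λ,μ}(x) dx converges and equals Γ(a+1) / Γ(λ·a + μ), where M_{λ,μ} is the two-parameter Mainardi function. -/
open MeasureTheory

lemma mm_norm_cpow_real (x : ℝ) (hx : 0 < x) (p : ℂ) : ‖(x : ℂ) ^ p‖ = x ^ p.re :=
  Complex.norm_cpow_eq_rpow_re_of_pos hx p

lemma mm_integrable_rpow_exp (a b : ℝ) (ha : -1 < a) (hb : 0 < b) :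
    IntegrableOn (fun x : ℝ => x ^ a * Real.exp (-b * x)) (Set.Ioi 0) := by
  have := integrableOn_rpow_mul_exp_neg_mul_rpow (p := 1) ha one_pos hb
  simpa using this

lemma mm_meas (p z : ℂ) : AEStronglyMeasurable
    (fun t : ℝ => (t : ℂ) ^ p * Complex.exp (-(z * t))) (volume.restrict (Set.Ioi 0)) := by
  refine ContinuousOn.aestronglyMeasurable ?_ measurableSet_Ioi
  intro t ht
  refine ContinuousAt.continuousWithinAt ?_
  have h1 : ContinuousAt (fun t : ℝ => (t : ℂ) ^ p) t :=
    Complex.continuousAt_ofReal_cpow_const t p (Or.inr (ne_of_gt ht))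
  exact h1.mul (by fun_prop)

lemma mm_laplace (p z : ℂ) (hp : 0 < p.re) (hz : 0 < z.re) :
    ∫ t in Set.Ioi (0 : ℝ), (t : ℂ) ^ (p - 1) * Complex.exp (-(z * t))
      = (1 / z) ^ p * Complex.Gamma p := by
  have hU : IsOpen {z : ℂ | 0 < z.re} := isOpen_lt continuous_const Complex.continuous_re
  have hd : DifferentiableOn ℂ (fun z : ℂ => ∫ t in Set.Ioi (0 : ℝ),
      (t : ℂ) ^ (p - 1) * Complex.exp (-(z * t))) {z : ℂ | 0 < z.re} := by
    intro w hw
    have hw' : 0 < w.re := hw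
    refine DifferentiableAt.differentiableWithinAt ?_
    have key := hasDerivAt_integral_of_dominated_loc_of_deriv_le
      (μ := volume.restrict (Set.Ioi (0:ℝ)))
      (F := fun (z : ℂ) (t : ℝ) => (t : ℂ) ^ (p - 1) * Complex.exp (-(z * t)))
      (F' := fun (z : ℂ) (t : ℝ) => (t : ℂ) ^ (p - 1) * (Complex.exp (-(z * t)) * (-t)))
      (x₀ := w) (s := Metric.ball w (w.re / 2))
      (bound := fun t : ℝ => t ^ p.re * Real.exp (-(w.re / 2) * t))
      (Metric.ball_mem_nhds _ (by positivity)) ?_ ?_ ?_ ?_ ?_ ?_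
    · exact key.2.differentiableAt
    · exact Filter.Eventually.of_forall fun z => mm_meas _ _
    · refine Integrable.mono' (mm_integrable_rpow_exp (p.re - 1) w.re (by linarith) hw')
        (mm_meas _ _) ?_
      refine (ae_restrict_mem measurableSet_Ioi).mono fun t ht => ?_
      rw [norm_mul, mm_norm_cpow_real t ht, Complex.norm_exp]
      simp
    · have := (mm_meas (p - 1) w).mul
        (Continuous.aestronglyMeasurable (μ := volume.restrict (Set.Ioi (0:ℝ)))
          (f := fun t : ℝ => -(t : ℂ)) (by fun_prop))
      refine this.congr (Filter.Eventually.of_forall fun t => ?_)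
      simp [mul_assoc]
    · refine (ae_restrict_mem measurableSet_Ioi).mono fun t ht z hz => ?_
      have ht' : (0:ℝ) < t := ht
      have hzre : w.re / 2 ≤ z.re := by
        have h1 : |(z - w).re| ≤ ‖z - w‖ := Complex.abs_re_le_norm _
        rw [Metric.mem_ball, dist_eq_norm] at hz
        have h2 := (abs_le.1 h1).1
        simp at h2
        linarith
      rw [norm_mul, norm_mul, mm_norm_cpow_real t ht, Complex.norm_exp]
      have e1 : t ^ (p - 1).re * t = t ^ p.re := by
        rw [← Real.rpow_add_one ht'.ne']; simp
      have e2 : ‖-(t:ℂ)‖ = t := by simp [abs_of_pos ht']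
      rw [e2]
      calc _ = (t ^ (p - 1).re * t) * Real.exp ((-(z * t)).re) := by ring
        _ ≤ _ := by
          rw [e1]
          gcongr
          simp
          nlinarith
    · exact mm_integrable_rpow_exp _ _ (by linarith) (by positivity)
    · refine Filter.Eventually.of_forall fun t z _ => ?_
      have : HasDerivAt (fun z : ℂ => -(z * t)) (-t : ℂ) z := by
        simpa using (hasDerivAt_mul_const (x := z) (t:ℂ)).fun_neg
      exact this.cexp.const_mul _
  have hd2 : DifferentiableOn ℂ (fun z : ℂ => (1 / z) ^ p * Complex.Gamma p)
      {z : ℂ | 0 < z.re} := by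
    intro w hw
    have hw' : 0 < w.re := hw
    have hw0 : w ≠ 0 := by rintro rfl; simp at hw'
    refine DifferentiableAt.differentiableWithinAt ?_
    refine DifferentiableAt.mul_const ?_ _
    refine DifferentiableAt.cpow_const (by fun_prop (disch := assumption)) ?_
    left
    simp only [one_div, Complex.inv_re]
    have : 0 < Complex.normSq w := Complex.normSq_pos.2 hw0
    positivity
  have heq := (hd.analyticOnNhd hU).eqOn_of_preconnected_of_frequently_eq (hd2.analyticOnNhd hU)
    (convex_halfSpace_re_gt 0).isPreconnected (z₀ := 1) (by simp) ?_
  · exact heq hz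
  · have ht : Filter.Tendsto (fun n : ℕ => ((1 + 1 / ((n:ℝ) + 1) : ℝ) : ℂ)) Filter.atTop
        (nhdsWithin 1 {1}ᶜ) := by
      refine tendsto_nhdsWithin_iff.2 ⟨?_, Filter.Eventually.of_forall fun n => ?_⟩
      · have h : Filter.Tendsto (fun n : ℕ => (1 + 1 / ((n:ℝ) + 1) : ℝ)) Filter.atTop (nhds (1 + 0)) :=
          tendsto_const_nhds.add tendsto_one_div_add_atTop_nhds_zero_nat
        have := (Complex.continuous_ofReal.tendsto _).comp h
        simpa only [add_zero, Complex.ofReal_one, Function.comp_def] using this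
      · simp only [Set.mem_compl_iff, Set.mem_singleton_iff]
        intro h
        have h' : (1 + 1 / ((n:ℝ) + 1) : ℝ) = 1 := by exact_mod_cast h
        have : (0:ℝ) < 1 / ((n:ℝ) + 1) := by positivity
        linarith
    refine ht.frequently (Filter.Frequently.of_forall fun n => ?_)
    exact Complex.integral_cpow_mul_exp_neg_mul_Ioi hp (by positivity)

lemma mm_poly_exp (K : ℕ) (b : ℝ) (hb : 0 < b) : ∃ C : ℝ, 0 ≤ C ∧ ∀ r : ℝ, 0 ≤ r →
    (1 + r) ^ K * Real.exp (-b * r) ≤ C * Real.exp (-(b / 2) * r) := by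
  set c : ℝ := b / (2 * (K + 1)) with hc
  have hc0 : 0 < c := by positivity
  refine ⟨(1 + 1 / c) ^ K, by positivity, fun r hr => ?_⟩
  have h1 : 1 + r ≤ (1 + 1 / c) * Real.exp (c * r) := by
    have e1 := Real.add_one_le_exp (c * r)
    have e2 : (1 + 1 / c) * (c * r + 1) ≤ (1 + 1 / c) * Real.exp (c * r) := by gcongr
    have e3 : (1 + 1 / c) * (c * r + 1) = c * r + 1 + r + 1 / c := by field_simp; ring
    have : 0 < 1 / c := by positivity
    have : 0 ≤ c * r := by positivity
    linarith
  have h2 : (1 + r) ^ K ≤ (1 + 1 / c) ^ K * Real.exp (K * (c * r)) := by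
    calc (1 + r) ^ K ≤ ((1 + 1 / c) * Real.exp (c * r)) ^ K := by gcongr
      _ = _ := by rw [mul_pow, ← Real.exp_nat_mul]
  have h3 : K * c ≤ b / 2 := by
    rw [hc]
    have : (K : ℝ) * (b / (2 * (K + 1))) = b / 2 * (K / (K + 1)) := by field_simp
    rw [this]
    have : (K : ℝ) / (K + 1) ≤ 1 := by rw [div_le_one (by positivity)]; linarith
    nlinarith
  calc (1 + r) ^ K * Real.exp (-b * r)
      ≤ ((1 + 1 / c) ^ K * Real.exp (K * (c * r))) * Real.exp (-b * r) := by gcongr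
    _ = (1 + 1 / c) ^ K * Real.exp (K * (c * r) + -b * r) := by rw [Real.exp_add]; ring
    _ ≤ _ := by
      gcongr
      nlinarith

lemma mm_cpow_bound (w : ℂ) (d : ℝ) (hd : 0 < d) : ∃ C : ℝ, ∃ K : ℕ, 0 ≤ C ∧
    ∀ (t : ℂ) (r : ℝ), 0 ≤ r → t ≠ 0 → ‖t‖ ≤ 1 + r → (d ≤ ‖t‖ ∨ 0 ≤ w.re) →
      ‖t ^ w‖ ≤ C * (1 + r) ^ K := by
  obtain ⟨K, hK⟩ := exists_nat_ge w.re
  refine ⟨Real.exp (Real.pi * |w.im|) * (1 + d ^ w.re), K, by positivity, fun t r hr ht htr h => ?_⟩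
  rw [Complex.norm_cpow_of_ne_zero ht, div_eq_mul_inv, ← Real.exp_neg]
  have h1 : -(t.arg * w.im) ≤ Real.pi * |w.im| := by
    have := neg_abs_le (t.arg * w.im)
    rw [abs_mul] at this
    have := mul_le_mul_of_nonneg_right (Complex.abs_arg_le_pi t) (abs_nonneg w.im)
    linarith
  have h1r : 1 ≤ 1 + r := by linarith
  have h2 : ‖t‖ ^ w.re ≤ (1 + d ^ w.re) * (1 + r) ^ K := by
    have hone : 1 ≤ (1 + r) ^ K := one_le_pow₀ h1r
    have hdp : 0 < d ^ w.re := by positivity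
    rcases le_or_gt 0 w.re with h0 | h0
    · calc ‖t‖ ^ w.re ≤ (1 + r) ^ w.re := by gcongr
        _ ≤ (1 + r) ^ (K : ℝ) := Real.rpow_le_rpow_of_exponent_le h1r hK
        _ = (1 + r) ^ K := Real.rpow_natCast _ _
        _ ≤ _ := by nlinarith
    · have hdt : d ≤ ‖t‖ := by
        rcases h with h | h
        · exact h
        · linarith
      calc ‖t‖ ^ w.re ≤ d ^ w.re := Real.rpow_le_rpow_of_nonpos hd hdt h0.le
        _ ≤ _ := by nlinarith
  calc ‖t‖ ^ w.re * Real.exp (-(t.arg * w.im))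
      ≤ ((1 + d ^ w.re) * (1 + r) ^ K) * Real.exp (Real.pi * |w.im|) := by gcongr
    _ = _ := by ring

lemma mm_f_bound (ω : ℂ) (h1 : ‖ω‖ = 1) (hre : ω.re < 0) (w : ℂ) (d : ℝ) (hd : 0 < d) :
    ∃ C : ℝ, 0 ≤ C ∧ ∀ c r : ℝ, 0 ≤ c → c ≤ 1 → 0 ≤ r → ((c : ℂ) + r * ω) ≠ 0 →
      (d ≤ ‖(c : ℂ) + r * ω‖ ∨ 0 ≤ w.re) →
      ‖Complex.exp ((c : ℂ) + r * ω) * ((c : ℂ) + r * ω) ^ w‖ ≤ C * Real.exp (-(-ω.re / 2) * r) := by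
  obtain ⟨C, K, hC, hb⟩ := mm_cpow_bound w d hd
  obtain ⟨D, hD, hb2⟩ := mm_poly_exp K (-ω.re) (by linarith)
  refine ⟨Real.exp 1 * C * D, by positivity, fun c r hc0 hc1 hr hne h => ?_⟩
  have hn : ‖(c : ℂ) + r * ω‖ ≤ 1 + r := by
    refine (norm_add_le _ _).trans ?_
    rw [norm_mul, h1]
    simp only [Complex.norm_real, Real.norm_eq_abs, abs_of_nonneg hc0, abs_of_nonneg hr]
    linarith
  have e1 := hb _ r hr hne hn h
  have e2 := hb2 r hr
  rw [norm_mul, Complex.norm_exp]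
  have e3 : ((c : ℂ) + r * ω).re = c + ω.re * r := by simp; ring
  rw [e3]
  calc Real.exp (c + ω.re * r) * ‖((c : ℂ) + r * ω) ^ w‖
      ≤ Real.exp (1 + ω.re * r) * (C * (1 + r) ^ K) := by gcongr
    _ = Real.exp 1 * C * ((1 + r) ^ K * Real.exp (-(-ω.re) * r)) := by
        rw [Real.exp_add]; ring_nf
    _ ≤ Real.exp 1 * C * (D * Real.exp (-(-ω.re / 2) * r)) := by gcongr
    _ = _ := by ring

lemma mm_slit (ω : ℂ) (him : ω.im ≠ 0) (c r : ℝ) (h : 0 < c ∨ r ≠ 0) (_hr : 0 ≤ c) :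
    (c : ℂ) + r * ω ∈ Complex.slitPlane := by
  rw [Complex.mem_slitPlane_iff]
  by_cases h0 : r = 0
  · left; subst h0; simpa using h
  · right; simp [h0, him]

lemma mm_lower (ω : ℂ) (h1 : ‖ω‖ = 1) (r : ℝ) : |ω.im| ≤ ‖(1 : ℂ) + r * ω‖ := by
  have e : ‖(1 : ℂ) + r * ω‖ = ‖(starRingEnd ℂ) ω + r‖ := by
    have : (1 : ℂ) + r * ω = ω * ((starRingEnd ℂ) ω + r) := by
      have : ω * (starRingEnd ℂ) ω = 1 := by
        rw [Complex.mul_conj, Complex.normSq_eq_norm_sq, h1]; simp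
      rw [mul_add, this]; ring
    rw [this, norm_mul, h1, one_mul]
  rw [e]
  have := Complex.abs_im_le_norm ((starRingEnd ℂ) ω + r)
  simpa using this

/-- integrability along the shifted ray -/
lemma mm_ray_integrable (ω : ℂ) (h1 : ‖ω‖ = 1) (hre : ω.re < 0) (him : ω.im ≠ 0) (w : ℂ) :
    IntegrableOn (fun r : ℝ => Complex.exp ((1 : ℂ) + r * ω) * ((1 : ℂ) + r * ω) ^ w)
      (Set.Ioi 0) := by
  obtain ⟨C, hC, hb⟩ := mm_f_bound ω h1 hre w |ω.im| (abs_pos.2 him)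
  refine Integrable.mono' (g := fun r => C * Real.exp (-(-ω.re / 2) * r)) ?_ ?_ ?_
  · exact (exp_neg_integrableOn_Ioi 0 (by linarith)).const_mul C
  · refine ContinuousOn.aestronglyMeasurable ?_ measurableSet_Ioi
    refine ContinuousOn.mul (by fun_prop) ?_
    refine ContinuousOn.cpow_const (by fun_prop) fun r hr => ?_
    simpa using mm_slit ω him 1 r (by simp) (by simp)
  · refine (ae_restrict_mem measurableSet_Ioi).mono fun r hr => ?_
    have hne : (1 : ℂ) + r * ω ≠ 0 :=
      Complex.slitPlane_ne_zero (by simpa using mm_slit ω him 1 r (by simp) (by simp))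
    simpa using hb 1 r (by simp) le_rfl (le_of_lt hr) (by simpa using hne)
      (by left; simpa using mm_lower ω h1 r)

lemma mm_tendsto (ω : ℂ) (h1 : ‖ω‖ = 1) (hre : ω.re < 0) (him : ω.im ≠ 0) (w : ℂ) (c d : ℝ)
    (hc : 0 < c) (hc1 : c ≤ 1) (hd : 0 < d)
    (h : ∀ r : ℝ, d ≤ ‖(c : ℂ) + r * ω‖ ∨ 0 ≤ w.re) :
    Filter.Tendsto (fun r : ℝ => Complex.exp ((c : ℂ) + r * ω) * ((c : ℂ) + r * ω) ^ w)
      Filter.atTop (nhds 0) := by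
  obtain ⟨C, hC, hb⟩ := mm_f_bound ω h1 hre w d hd
  refine squeeze_zero_norm' (a := fun r => C * Real.exp (-(-ω.re / 2) * r)) ?_ ?_
  · filter_upwards [Filter.eventually_ge_atTop 0] with r hr
    exact hb c r hc.le hc1 hr (Complex.slitPlane_ne_zero (mm_slit ω him c r (Or.inl hc) hc.le)) (h r)
  · rw [← mul_zero C]
    refine Filter.Tendsto.const_mul C ?_
    refine Real.tendsto_exp_atBot.comp ?_
    exact Filter.tendsto_id.const_mul_atTop_of_neg (by linarith)

lemma mm_deriv_f (w t : ℂ) (ht : t ∈ Complex.slitPlane) :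
    HasDerivAt (fun t : ℂ => Complex.exp t * t ^ w)
      (Complex.exp t * t ^ w + w * (Complex.exp t * t ^ (w - 1))) t := by
  have := (Complex.hasDerivAt_exp t).mul (Complex.hasStrictDerivAt_cpow_const (c := w) ht).hasDerivAt
  exact this.congr_deriv (by ring)

lemma mm_deriv_r (ω w : ℂ) (him : ω.im ≠ 0) (c r : ℝ) (h : 0 < c ∨ r ≠ 0) (hc : 0 ≤ c) :
    HasDerivAt (fun r : ℝ => Complex.exp ((c : ℂ) + r * ω) * ((c : ℂ) + r * ω) ^ w)
      ((Complex.exp ((c : ℂ) + r * ω) * ((c : ℂ) + r * ω) ^ w +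
        w * (Complex.exp ((c : ℂ) + r * ω) * ((c : ℂ) + r * ω) ^ (w - 1))) * ω) r := by
  have h1 := mm_deriv_f w _ (mm_slit ω him c r h hc)
  have h2 : HasDerivAt (fun r : ℝ => (c : ℂ) + r * ω) ω r := by
    simpa using ((Complex.ofRealCLM.hasDerivAt (x := r)).mul_const ω).const_add (c : ℂ)
  exact h1.comp r h2

lemma mm_deriv_c (ω w : ℂ) (him : ω.im ≠ 0) (c r : ℝ) (h : 0 < c ∨ r ≠ 0) (hc : 0 ≤ c) :
    HasDerivAt (fun c : ℝ => Complex.exp ((c : ℂ) + r * ω) * ((c : ℂ) + r * ω) ^ w)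
      (Complex.exp ((c : ℂ) + r * ω) * ((c : ℂ) + r * ω) ^ w +
        w * (Complex.exp ((c : ℂ) + r * ω) * ((c : ℂ) + r * ω) ^ (w - 1))) c := by
  have h1 := mm_deriv_f w _ (mm_slit ω him c r h hc)
  have h2 : HasDerivAt (fun c : ℝ => (c : ℂ) + r * ω) 1 c := by
    simpa using ((Complex.ofRealCLM.hasDerivAt (x := c))).add_const ((r : ℂ) * ω)
  have h3 := h1.comp c h2
  rw [mul_one] at h3
  exact h3

/-- The integral along the shifted ray. -/
noncomputable def mmR (ω w : ℂ) : ℂ :=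
  ∫ r in Set.Ioi (0 : ℝ), Complex.exp ((1 : ℂ) + r * ω) * ((1 : ℂ) + r * ω) ^ w

lemma mmR_rec (ω : ℂ) (h1 : ‖ω‖ = 1) (hre : ω.re < 0) (him : ω.im ≠ 0) (w : ℂ) :
    ω * mmR ω w = - w * (ω * mmR ω (w - 1)) - Complex.exp 1 := by
  have i1 := mm_ray_integrable ω h1 hre him w
  have i2 := mm_ray_integrable ω h1 hre him (w - 1)
  have key := integral_Ioi_of_hasDerivAt_of_tendsto (a := 0) (m := 0)
    (f := fun r : ℝ => Complex.exp ((1 : ℂ) + r * ω) * ((1 : ℂ) + r * ω) ^ w)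
    (f' := fun r : ℝ => (Complex.exp ((1 : ℂ) + r * ω) * ((1 : ℂ) + r * ω) ^ w +
        w * (Complex.exp ((1 : ℂ) + r * ω) * ((1 : ℂ) + r * ω) ^ (w - 1))) * ω)
    ?_ ?_ ?_ ?_
  · rw [integral_mul_const, integral_add i1 (i2.const_mul w), integral_const_mul] at key
    simp only [Complex.ofReal_zero, zero_mul, add_zero, Complex.one_cpow, mul_one] at key
    unfold mmR
    linear_combination key
  · have := (mm_deriv_r ω w him 1 0 (by simp) (by simp)).continuousAt.continuousWithinAt (s := Set.Ici 0)
    simpa using this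
  · intro r hr
    simpa using mm_deriv_r ω w him 1 r (by simp) (by simp)
  · exact (i1.add (i2.const_mul w)).mul_const ω
  · simpa using mm_tendsto ω h1 hre him w 1 |ω.im| one_pos le_rfl (abs_pos.2 him)
      (fun r => Or.inl (by simpa using mm_lower ω h1 r))

lemma mm_2d (ω : ℂ) (h1 : ‖ω‖ = 1) (hre : ω.re < 0) (him : ω.im ≠ 0) (w : ℂ) (hw : 0 ≤ w.re) :
    Integrable (fun q : ℝ × ℝ => Complex.exp ((q.1 : ℂ) + q.2 * ω) * ((q.1 : ℂ) + q.2 * ω) ^ w)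
      ((volume.restrict (Set.Ioc (0:ℝ) 1)).prod (volume.restrict (Set.Ioi (0:ℝ)))) := by
  obtain ⟨C, hC, hb⟩ := mm_f_bound ω h1 hre w 1 one_pos
  have hg : Integrable (fun q : ℝ × ℝ => C * Real.exp (-(-ω.re / 2) * q.2))
      ((volume.restrict (Set.Ioc (0:ℝ) 1)).prod (volume.restrict (Set.Ioi (0:ℝ)))) :=
    Integrable.mul_prod (f := fun _ : ℝ => C) (integrable_const C)
      (exp_neg_integrableOn_Ioi 0 (by linarith))
  rw [Measure.prod_restrict] at hg ⊢
  have hms : MeasurableSet (Set.Ioc (0:ℝ) 1 ×ˢ Set.Ioi (0:ℝ)) :=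
    measurableSet_Ioc.prod measurableSet_Ioi
  refine hg.mono' ?_ ?_
  · refine ContinuousOn.aestronglyMeasurable ?_ hms
    refine ContinuousOn.mul (by fun_prop) ?_
    refine ContinuousOn.cpow_const (by fun_prop) fun q hq => ?_
    exact mm_slit ω him q.1 q.2 (Or.inl hq.1.1) hq.1.1.le
  · refine (ae_restrict_mem hms).mono fun q hq => ?_
    exact hb q.1 q.2 hq.1.1.le hq.1.2 (le_of_lt hq.2)
      (Complex.slitPlane_ne_zero (mm_slit ω him q.1 q.2 (Or.inl hq.1.1) hq.1.1.le)) (Or.inr hw)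

lemma mm_ray0_integrable (ω : ℂ) (h1 : ‖ω‖ = 1) (hre : ω.re < 0) (him : ω.im ≠ 0) (w : ℂ)
    (hw : 0 ≤ w.re) :
    IntegrableOn (fun r : ℝ => Complex.exp (r * ω) * (r * ω) ^ w) (Set.Ioi 0) := by
  obtain ⟨C, hC, hb⟩ := mm_f_bound ω h1 hre w 1 one_pos
  have hs : ∀ r : ℝ, r ∈ Set.Ioi (0:ℝ) → (r : ℂ) * ω ∈ Complex.slitPlane := fun r hr => by
    simpa using mm_slit ω him 0 r (Or.inr (ne_of_gt hr)) le_rfl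
  refine Integrable.mono' (g := fun r => C * Real.exp (-(-ω.re / 2) * r)) ?_ ?_ ?_
  · exact (exp_neg_integrableOn_Ioi 0 (by linarith)).const_mul C
  · refine ContinuousOn.aestronglyMeasurable ?_ measurableSet_Ioi
    refine ContinuousOn.mul (by fun_prop) ?_
    exact ContinuousOn.cpow_const (by fun_prop) fun r hr => hs r hr
  · refine (ae_restrict_mem measurableSet_Ioi).mono fun r hr => ?_
    simpa using hb 0 r (by simp) (by simp) (le_of_lt hr)
      (by simpa using Complex.slitPlane_ne_zero (hs r hr)) (Or.inr hw)

lemma mmR_shift (ω : ℂ) (h1 : ‖ω‖ = 1) (hre : ω.re < 0) (him : ω.im ≠ 0) (w : ℂ) (hw : 1 ≤ w.re) :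
    ω * mmR ω w = ω * (∫ r in Set.Ioi (0 : ℝ), Complex.exp (r * ω) * (r * ω) ^ w)
      - ∫ c in Set.Ioc (0:ℝ) 1, Complex.exp (c : ℂ) * (c : ℂ) ^ w := by
  have a1 := mm_2d ω h1 hre him w (by linarith)
  have a2 := mm_2d ω h1 hre him (w - 1) (by simp; linarith)
  have a3 := a1.add (a2.const_mul w)
  have swap := integral_integral_swap (f := fun (c r : ℝ) =>
    (Complex.exp ((c : ℂ) + r * ω) * ((c : ℂ) + r * ω) ^ w +
        w * (Complex.exp ((c : ℂ) + r * ω) * ((c : ℂ) + r * ω) ^ (w - 1)))) a3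
  have L : ∫ c in Set.Ioc (0:ℝ) 1, ω * (∫ r in Set.Ioi (0 : ℝ),
      (Complex.exp ((c : ℂ) + r * ω) * ((c : ℂ) + r * ω) ^ w +
        w * (Complex.exp ((c : ℂ) + r * ω) * ((c : ℂ) + r * ω) ^ (w - 1))))
      = - ∫ c in Set.Ioc (0:ℝ) 1, Complex.exp (c : ℂ) * (c : ℂ) ^ w := by
    rw [← integral_neg]
    have hae := a3.prod_right_ae
    refine integral_congr_ae ?_
    filter_upwards [hae, ae_restrict_mem measurableSet_Ioc] with c hc hc2
    have key := integral_Ioi_of_hasDerivAt_of_tendsto (a := 0) (m := 0)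
      (f := fun r : ℝ => Complex.exp ((c : ℂ) + r * ω) * ((c : ℂ) + r * ω) ^ w)
      (f' := fun r : ℝ => (Complex.exp ((c : ℂ) + r * ω) * ((c : ℂ) + r * ω) ^ w +
        w * (Complex.exp ((c : ℂ) + r * ω) * ((c : ℂ) + r * ω) ^ (w - 1))) * ω)
      (mm_deriv_r ω w him c 0 (Or.inl hc2.1) hc2.1.le).continuousAt.continuousWithinAt
      (fun r hr => mm_deriv_r ω w him c r (Or.inl hc2.1) hc2.1.le)
      (Integrable.mul_const hc ω)
      (mm_tendsto ω h1 hre him w c 1 hc2.1 hc2.2 one_pos (fun r => Or.inr (by linarith)))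
    rw [integral_mul_const] at key
    simp only [Complex.ofReal_zero, zero_mul, add_zero] at key
    rw [mul_comm, key]; ring
  have Rr : ∫ r in Set.Ioi (0 : ℝ), ∫ c in Set.Ioc (0:ℝ) 1,
      (Complex.exp ((c : ℂ) + r * ω) * ((c : ℂ) + r * ω) ^ w +
        w * (Complex.exp ((c : ℂ) + r * ω) * ((c : ℂ) + r * ω) ^ (w - 1)))
      = mmR ω w - ∫ r in Set.Ioi (0 : ℝ), Complex.exp (r * ω) * (r * ω) ^ w := by
    unfold mmR
    rw [← integral_sub (mm_ray_integrable ω h1 hre him w)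
      (mm_ray0_integrable ω h1 hre him w (by linarith))]
    have hae := a3.prod_left_ae
    refine integral_congr_ae ?_
    filter_upwards [hae, ae_restrict_mem measurableSet_Ioi] with r hr hr2
    have hr0 : r ≠ 0 := ne_of_gt hr2
    have key := intervalIntegral.integral_eq_sub_of_hasDerivAt (a := 0) (b := 1)
      (f := fun c : ℝ => Complex.exp ((c : ℂ) + r * ω) * ((c : ℂ) + r * ω) ^ w)
      (f' := fun c : ℝ => (Complex.exp ((c : ℂ) + r * ω) * ((c : ℂ) + r * ω) ^ w +
        w * (Complex.exp ((c : ℂ) + r * ω) * ((c : ℂ) + r * ω) ^ (w - 1))))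
      (fun c hc => mm_deriv_c ω w him c r (Or.inr hr0) (by
        rw [Set.uIcc_of_le zero_le_one] at hc; exact hc.1))
      ((intervalIntegrable_iff_integrableOn_Ioc_of_le zero_le_one).2 hr)
    rw [intervalIntegral.integral_of_le zero_le_one] at key
    rw [key]
    simp
  rw [Rr] at swap
  rw [integral_const_mul, swap] at L
  linear_combination L

lemma mm_ray0 (ω L L' w : ℂ) (hre : ω.re < 0) (hL : Complex.exp L = ω)
    (hL1 : -Real.pi < L.im) (hL2 : L.im ≤ Real.pi) (hL' : Complex.exp L' = 1 / (-ω))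
    (hL1' : -Real.pi < L'.im) (hL2' : L'.im ≤ Real.pi) (hw : 1 ≤ w.re) :
    ω * (∫ r in Set.Ioi (0 : ℝ), Complex.exp (r * ω) * (r * ω) ^ w)
      = Complex.exp ((L + L') * (w + 1)) * Complex.Gamma (w + 1) := by
  have hω : ω ≠ 0 := by rw [← hL]; exact Complex.exp_ne_zero _
  have h := mm_laplace (w + 1) (-ω) (by simp; linarith) (by simpa using hre)
  have e : ∫ r in Set.Ioi (0 : ℝ), Complex.exp (r * ω) * (r * ω) ^ w
      = ω ^ w * ∫ t in Set.Ioi (0 : ℝ), (t : ℂ) ^ (w + 1 - 1) * Complex.exp (-(-ω * t)) := by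
    rw [← integral_const_mul]
    refine setIntegral_congr_fun measurableSet_Ioi fun r hr => ?_
    have hr' : (0:ℝ) < r := hr
    simp only [add_sub_cancel_right, neg_mul, neg_neg]
    have hr0 : (r : ℂ) ≠ 0 := Complex.ofReal_ne_zero.2 hr'.ne'
    rw [Complex.cpow_def_of_ne_zero (mul_ne_zero hr0 hω), Complex.log_ofReal_mul hr' hω,
      Complex.cpow_def_of_ne_zero hr0, Complex.cpow_def_of_ne_zero hω, Complex.ofReal_log hr'.le,
      add_mul, Complex.exp_add, mul_comm ω]
    ring
  rw [e, h]
  have e1 : ω * ω ^ w = Complex.exp (L * (w + 1)) := by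
    rw [Complex.cpow_def_of_ne_zero hω, ← hL, Complex.log_exp hL1 hL2, ← Complex.exp_add]
    ring_nf
  have e2 : (1 / -ω) ^ (w + 1) = Complex.exp (L' * (w + 1)) := by
    rw [← hL', Complex.cpow_def_of_ne_zero (Complex.exp_ne_zero _), Complex.log_exp hL1' hL2']
  rw [e2, add_mul, Complex.exp_add, ← e1]
  ring

/-- the Hankel difference of the two rays -/
noncomputable def mmD (θ : ℝ) (w : ℂ) : ℂ :=
  Complex.exp (θ * Complex.I) * mmR (Complex.exp (θ * Complex.I)) w
   - Complex.exp ((-θ : ℝ) * Complex.I) * mmR (Complex.exp ((-θ : ℝ) * Complex.I)) w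

lemma mm_om (θ : ℝ) (h1 : Real.pi / 2 < θ) (h2 : θ < Real.pi) :
    (‖Complex.exp (θ * Complex.I)‖ = 1 ∧ (Complex.exp (θ * Complex.I)).re < 0 ∧
      (Complex.exp (θ * Complex.I)).im ≠ 0 ∧ (Complex.exp (θ * Complex.I)).re = Real.cos θ) ∧
    (‖Complex.exp ((-θ : ℝ) * Complex.I)‖ = 1 ∧ (Complex.exp ((-θ : ℝ) * Complex.I)).re < 0 ∧
      (Complex.exp ((-θ : ℝ) * Complex.I)).im ≠ 0 ∧
      (Complex.exp ((-θ : ℝ) * Complex.I)).re = Real.cos θ) := by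
  have hc : Real.cos θ < 0 := Real.cos_neg_of_pi_div_two_lt_of_lt h1 (by linarith [Real.pi_pos])
  have hs : 0 < Real.sin θ := Real.sin_pos_of_pos_of_lt_pi (by linarith [Real.pi_pos]) h2
  refine ⟨⟨Complex.norm_exp_ofReal_mul_I _, ?_, ?_, ?_⟩, ⟨Complex.norm_exp_ofReal_mul_I _, ?_, ?_, ?_⟩⟩ <;>
  simp only [Complex.exp_ofReal_mul_I_re, Complex.exp_ofReal_mul_I_im, Real.cos_neg, Real.sin_neg]
  · exact hc
  · exact hs.ne'
  · exact hc
  · exact neg_ne_zero.2 hs.ne'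

lemma mmD_base (θ : ℝ) (h1 : Real.pi / 2 < θ) (h2 : θ < Real.pi) (w : ℂ) (hw : 1 ≤ w.re) :
    mmD θ w = 2 * Real.pi * Complex.I / Complex.Gamma (-w) := by
  obtain ⟨⟨a1, a2, a3, -⟩, ⟨b1, b2, b3, -⟩⟩ := mm_om θ h1 h2
  have hp := Real.pi_pos
  unfold mmD
  rw [mmR_shift _ a1 a2 a3 w hw, mmR_shift _ b1 b2 b3 w hw]
  have r1 := mm_ray0 (Complex.exp (θ * Complex.I)) (θ * Complex.I) ((Real.pi - θ : ℝ) * Complex.I) w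
    a2 rfl (by simp; linarith) (by simp; linarith)
    (by
      have : ((Real.pi - θ : ℝ) : ℂ) * Complex.I = Real.pi * Complex.I - θ * Complex.I := by
        push_cast; ring
      rw [this, Complex.exp_sub, Complex.exp_pi_mul_I, one_div_neg_eq_neg_one_div, neg_div])
    (by simp; linarith) (by simp; linarith) hw
  have r2 := mm_ray0 (Complex.exp ((-θ : ℝ) * Complex.I)) ((-θ : ℝ) * Complex.I)
    ((θ - Real.pi : ℝ) * Complex.I) w
    b2 rfl (by simp; linarith) (by simp; linarith)
    (by
      have : ((θ - Real.pi : ℝ) : ℂ) * Complex.I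
          = -((-θ : ℝ) * Complex.I) - Real.pi * Complex.I := by
        push_cast; ring
      rw [this, Complex.exp_sub, Complex.exp_pi_mul_I, one_div_neg_eq_neg_one_div, Complex.exp_neg, div_neg, div_one, one_div])
    (by simp; linarith) (by simp; linarith) hw
  rw [r1, r2]
  have e1 : ((θ : ℂ) * Complex.I + ((Real.pi - θ : ℝ) : ℂ) * Complex.I) * (w + 1)
      = (Real.pi * w) * Complex.I + Real.pi * Complex.I := by push_cast; ring
  have e2 : (((-θ : ℝ) : ℂ) * Complex.I + ((θ - Real.pi : ℝ) : ℂ) * Complex.I) * (w + 1)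
      = -(Real.pi * w) * Complex.I - Real.pi * Complex.I := by push_cast; ring
  rw [e1, e2, Complex.exp_add, Complex.exp_sub, Complex.exp_pi_mul_I]
  have hs : Complex.sin (Real.pi * -w) =
      (Complex.exp (Real.pi * w * Complex.I) - Complex.exp (-(Real.pi * w) * Complex.I))
        * Complex.I / 2 := by
    rw [Complex.sin]; ring_nf
  have hG := Complex.Gamma_mul_Gamma_one_sub (-w)
  have hG0 : Complex.Gamma (w + 1) ≠ 0 := Complex.Gamma_ne_zero_of_re_pos (by simp; linarith)
  have e3 : 1 - -w = w + 1 := by ring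
  rw [e3] at hG
  have goal2 : 2 * Complex.I * Complex.sin (Real.pi * -w) * Complex.Gamma (w + 1)
      = 2 * Real.pi * Complex.I / Complex.Gamma (-w) := by
    by_cases hz : Complex.sin (Real.pi * -w) = 0
    · rw [hz, div_zero] at hG
      have : Complex.Gamma (-w) = 0 := by
        rcases mul_eq_zero.1 hG with h | h
        · exact h
        · exact absurd h hG0
      rw [hz, this]; simp
    · have hgw : Complex.Gamma (-w) ≠ 0 := by
        intro h
        rw [h, zero_mul] at hG
        have := div_ne_zero (Complex.ofReal_ne_zero.2 hp.ne') hz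
        exact this hG.symm
      rw [eq_div_iff hgw]
      rw [eq_div_iff hz] at hG
      linear_combination 2 * Complex.I * hG
  rw [← goal2, hs]
  linear_combination (-Complex.exp (Real.pi * w * Complex.I) + Complex.exp (-(Real.pi * w) * Complex.I))
    * Complex.Gamma (w + 1) * Complex.I_sq

lemma mmD_rec (θ : ℝ) (h1 : Real.pi / 2 < θ) (h2 : θ < Real.pi) (w : ℂ) :
    mmD θ w = -w * mmD θ (w - 1) := by
  obtain ⟨⟨a1, a2, a3, -⟩, ⟨b1, b2, b3, -⟩⟩ := mm_om θ h1 h2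
  unfold mmD
  rw [mmR_rec _ a1 a2 a3 w, mmR_rec _ b1 b2 b3 w]
  ring

lemma mmD_step (θ : ℝ) (h1 : Real.pi / 2 < θ) (h2 : θ < Real.pi) (w : ℂ) (hw : w ≠ 0)
    (h : mmD θ w = 2 * Real.pi * Complex.I / Complex.Gamma (-w)) :
    mmD θ (w - 1) = 2 * Real.pi * Complex.I / Complex.Gamma (-(w - 1)) := by
  have e : -(w - 1) = -w + 1 := by ring
  rw [e, Complex.Gamma_add_one _ (neg_ne_zero.2 hw)]
  rw [mmD_rec θ h1 h2] at h
  have : mmD θ (w - 1) = (-w * mmD θ (w - 1)) / (-w) := by field_simp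
  rw [this, h, div_div, mul_comm (-w)]

lemma mmD_generic (θ : ℝ) (h1 : Real.pi / 2 < θ) (h2 : θ < Real.pi) (n : ℕ) : ∀ w : ℂ,
    1 ≤ w.re + n → (∀ k : ℕ, w + k + 1 ≠ 0) →
    mmD θ w = 2 * Real.pi * Complex.I / Complex.Gamma (-w) := by
  induction n with
  | zero => intro w hw _; exact mmD_base θ h1 h2 w (by simpa using hw)
  | succ n ih =>
    intro w hw hk
    have h := ih (w + 1) (by simp at hw ⊢; linarith) (fun k => by
      have := hk (k + 1)
      push_cast at this
      intro h0
      apply this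
      rw [← h0]; ring)
    have h3 := mmD_step θ h1 h2 (w + 1) (by simpa using hk 0) h
    simpa using h3

lemma mmR_cont (ω : ℂ) (h1 : ‖ω‖ = 1) (hre : ω.re < 0) (him : ω.im ≠ 0) (u : ℕ → ℝ)
    (hu : ∀ n, -1 ≤ u n ∧ u n ≤ 0) (hl : Filter.Tendsto u Filter.atTop (nhds (-1))) :
    Filter.Tendsto (fun n => mmR ω (u n)) Filter.atTop (nhds (mmR ω (-1))) := by
  have i1 := mm_ray_integrable ω h1 hre him (-1)
  have i2 := mm_ray_integrable ω h1 hre him 0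
  have hne : ∀ r : ℝ, (1 : ℂ) + r * ω ≠ 0 := fun r =>
      Complex.slitPlane_ne_zero (by simpa using mm_slit ω him 1 r (by simp) (by simp))
  unfold mmR
  refine tendsto_integral_of_dominated_convergence
    (fun r : ℝ => ‖Complex.exp ((1 : ℂ) + r * ω) * ((1 : ℂ) + r * ω) ^ (-1 : ℂ)‖
      + ‖Complex.exp ((1 : ℂ) + r * ω) * ((1 : ℂ) + r * ω) ^ (0 : ℂ)‖) ?_ ?_ ?_ ?_
  · exact fun n => (mm_ray_integrable ω h1 hre him (u n)).aestronglyMeasurable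
  · exact i1.norm.add i2.norm
  · intro n
    refine Filter.Eventually.of_forall fun r => ?_
    simp only [norm_mul]
    rw [← mul_add]
    gcongr
    have ht : 0 < ‖(1 : ℂ) + r * ω‖ := norm_pos_iff.2 (hne r)
    rw [Complex.norm_cpow_of_ne_zero (hne r), Complex.norm_cpow_of_ne_zero (hne r),
      Complex.norm_cpow_of_ne_zero (hne r)]
    simp only [Complex.ofReal_re, Complex.ofReal_im, mul_zero, Real.exp_zero, div_one,
      Complex.neg_re, Complex.one_re, Complex.neg_im, Complex.one_im, neg_zero, Complex.zero_re,
      Complex.zero_im, Real.rpow_zero]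
    rcases le_total ‖(1 : ℂ) + r * ω‖ 1 with h | h
    · have := Real.rpow_le_rpow_of_exponent_ge ht h (hu n).1
      linarith
    · have := Real.rpow_le_rpow_of_exponent_le h (hu n).2
      rw [Real.rpow_zero] at this
      have := Real.rpow_nonneg ht.le (-1)
      linarith
  · refine Filter.Eventually.of_forall fun r => ?_
    refine Filter.Tendsto.const_mul _ ?_
    have hc : Filter.Tendsto (fun n => (u n : ℂ)) Filter.atTop (nhds (-1)) := by
      have := (Complex.continuous_ofReal.tendsto (-1)).comp hl
      simpa [Function.comp_def] using this
    exact ((continuousAt_const_cpow (hne r)).tendsto).comp hc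

lemma mmD_neg_one (θ : ℝ) (h1 : Real.pi / 2 < θ) (h2 : θ < Real.pi) :
    mmD θ (-1) = 2 * Real.pi * Complex.I / Complex.Gamma (-(-1)) := by
  obtain ⟨⟨a1, a2, a3, -⟩, ⟨b1, b2, b3, -⟩⟩ := mm_om θ h1 h2
  set u : ℕ → ℝ := fun n => -1 + 1 / ((n : ℝ) + 1) / 2 with hu
  have hub : ∀ n : ℕ, 0 < 1 / ((n : ℝ) + 1) / 2 ∧ 1 / ((n : ℝ) + 1) / 2 < 1 := fun n => by
    refine ⟨by positivity, ?_⟩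
    have : 1 / ((n : ℝ) + 1) ≤ 1 := by
      rw [div_le_one (by positivity)]
      have : (0:ℝ) ≤ n := by positivity
      linarith
    linarith
  have hl : Filter.Tendsto u Filter.atTop (nhds (-1)) := by
    have := (tendsto_one_div_add_atTop_nhds_zero_nat (𝕜 := ℝ)).div_const 2
    have := this.const_add (-1)
    simpa [hu] using this
  have hu2 : ∀ n, -1 ≤ u n ∧ u n ≤ 0 := fun n => by
    have := hub n
    simp only [hu]
    constructor <;> linarith
  have t1 : Filter.Tendsto (fun n => mmD θ (u n)) Filter.atTop (nhds (mmD θ (-1))) := by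
    unfold mmD
    exact ((mmR_cont _ a1 a2 a3 u hu2 hl).const_mul _).sub ((mmR_cont _ b1 b2 b3 u hu2 hl).const_mul _)
  have t2 : Filter.Tendsto (fun n => 2 * Real.pi * Complex.I / Complex.Gamma (-(u n : ℂ))) Filter.atTop
      (nhds (2 * Real.pi * Complex.I / Complex.Gamma (-(-1)))) := by
    refine Filter.Tendsto.div tendsto_const_nhds ?_ (by simp)
    have hc : ContinuousAt Complex.Gamma (-(-1)) := by
      refine (Complex.differentiableAt_Gamma _ fun m hm => ?_).continuousAt
      have := congrArg Complex.re hm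
      simp at this
      have : (0:ℝ) ≤ m := by positivity
      linarith
    have hc2 : Filter.Tendsto (fun n => -(u n : ℂ)) Filter.atTop (nhds (-(-1))) := by
      have := (Complex.continuous_ofReal.tendsto (-1)).comp hl
      simpa [Function.comp_def] using this.neg
    exact hc.tendsto.comp hc2
  refine tendsto_nhds_unique t1 (t2.congr fun n => ?_)
  refine (mmD_generic θ h1 h2 2 (u n) ?_ ?_).symm
  · have := (hu2 n).1
    simp only [Complex.ofReal_re]
    push_cast
    linarith
  · intro k hk
    have hk' : u n + k + 1 = 0 := by exact_mod_cast hk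
    simp only [hu] at hk'
    have h0 := hub n
    have : (0:ℝ) ≤ k := by positivity
    linarith

/-- Hankel's formula. -/
lemma mmD_eq (θ : ℝ) (h1 : Real.pi / 2 < θ) (h2 : θ < Real.pi) (w : ℂ) :
    mmD θ w = 2 * Real.pi * Complex.I / Complex.Gamma (-w) := by
  by_cases h : ∀ k : ℕ, w + k + 1 ≠ 0
  · obtain ⟨n, hn⟩ := exists_nat_ge (1 - w.re)
    exact mmD_generic θ h1 h2 n w (by linarith) h
  · push Not at h
    obtain ⟨k, hk⟩ := h
    have hw : w = -1 - k := by linear_combination hk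
    rw [hw]
    clear hw hk
    induction k with
    | zero => simpa using mmD_neg_one θ h1 h2
    | succ k ih =>
      have h0 : (-1 - (k:ℂ)) ≠ 0 := by
        intro h
        have := congrArg Complex.re h
        simp at this
        have : (0:ℝ) ≤ k := by positivity
        linarith
      have := mmD_step θ h1 h2 _ h0 ih
      have e : (-1 - ((k + 1 : ℕ) : ℂ)) = -1 - (k:ℂ) - 1 := by push_cast; ring
      rw [e]; exact this

/-- The two-parameter Mainardi function `M_{λ,μ}(z) = ∑ (−z)^n / (n! Γ(μ − (n+1)λ))`,
with the convention that `1/Γ` vanishes at the nonpositive integers (which is the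
behaviour of `Complex.Gamma` composed with division by zero). -/
noncomputable def mainardi (lam : ℝ) (mu : ℂ) (z : ℂ) : ℂ :=
  ∑' n : ℕ, (-z) ^ n / ((n.factorial : ℂ) * Complex.Gamma (mu - ((n : ℂ) + 1) * (lam : ℂ)))

lemma mm_cone (ω : ℂ) (h1 : ‖ω‖ = 1) (hre : ω.re < 0) (him : ω.im ≠ 0) (θ lam : ℝ)
    (hθ0 : 0 ≤ θ) (hθ : θ ≤ Real.pi) (hc : ω.re = Real.cos θ) (hl : 0 ≤ lam)
    (hlθ : lam * θ < Real.pi / 2) : ∃ η : ℝ, 0 < η ∧ ∀ r : ℝ, 0 ≤ r →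
      |((1 : ℂ) + r * ω).arg| * lam < Real.pi / 2 ∧ η ≤ (((1 : ℂ) + r * ω) ^ (lam : ℂ)).re := by
  have hcos : 0 < Real.cos (lam * θ) :=
    Real.cos_pos_of_mem_Ioo ⟨by have := Real.pi_pos; have : 0 ≤ lam * θ := by positivity
                                linarith, hlθ⟩
  have him' : 0 < |ω.im| := abs_pos.2 him
  refine ⟨|ω.im| ^ lam * Real.cos (lam * θ), by positivity, fun r hr => ?_⟩
  have hne : (1 : ℂ) + r * ω ≠ 0 :=
      Complex.slitPlane_ne_zero (by simpa using mm_slit ω him 1 r (by simp) (by simp))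
  have hpos : 0 < ‖(1 : ℂ) + r * ω‖ := norm_pos_iff.2 hne
  have harg : |((1 : ℂ) + r * ω).arg| ≤ θ := by
    by_contra hcon
    push Not at hcon
    have hlt := Real.strictAntiOn_cos ⟨hθ0, hθ⟩ ⟨abs_nonneg _, Complex.abs_arg_le_pi _⟩ hcon
    rw [Real.cos_abs, Complex.cos_arg hne, div_lt_iff₀ hpos, ← hc] at hlt
    have e : ((1 : ℂ) + r * ω).re = 1 + r * ω.re := by simp
    rw [e] at hlt
    have hn : r - 1 ≤ ‖(1 : ℂ) + r * ω‖ := by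
      have := norm_sub_norm_le ((r : ℂ) * ω) (-1)
      rw [norm_mul, h1, norm_neg, norm_one, Complex.norm_real, Real.norm_eq_abs, abs_of_nonneg hr,
        sub_neg_eq_add, add_comm ((r : ℂ) * ω)] at this
      linarith
    have hre1 : -1 ≤ ω.re := by
      have := Complex.abs_re_le_norm ω
      rw [h1] at this
      exact (abs_le.1 this).1
    nlinarith
  have h3 : |((1 : ℂ) + r * ω).arg| * lam ≤ lam * θ := by nlinarith
  refine ⟨lt_of_le_of_lt h3 hlθ, ?_⟩
  rw [Complex.cpow_ofReal_re]
  have h4 : Real.cos (lam * θ) ≤ Real.cos (((1 : ℂ) + r * ω).arg * lam) := by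
    rw [← Real.cos_abs (((1 : ℂ) + r * ω).arg * lam), abs_mul, abs_of_nonneg hl]
    exact Real.cos_le_cos_of_nonneg_of_le_pi (by positivity) (by linarith [Real.pi_pos]) h3
  have := mm_lower ω h1 r
  gcongr

lemma mm_sublinear (lam x b : ℝ) (hl : 0 ≤ lam) (hl1 : lam < 1) (hx : 0 ≤ x) (hb : 0 < b) :
    ∃ C : ℝ, ∀ y : ℝ, 0 < y → x * y ^ lam ≤ C + b * y := by
  have ht : Filter.Tendsto (fun y : ℝ => x * y ^ (-(1 - lam))) Filter.atTop (nhds (x * 0)) :=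
    (tendsto_rpow_neg_atTop (by linarith)).const_mul x
  rw [mul_zero] at ht
  obtain ⟨Y, hY⟩ := Filter.eventually_atTop.1 (ht.eventually (gt_mem_nhds hb))
  refine ⟨x * |Y| ^ lam, fun y hy => ?_⟩
  rcases le_total Y y with h | h
  · have h1 := hY y h
    have h2 : y ^ lam = y ^ (-(1 - lam)) * y := by
      rw [← Real.rpow_add_one hy.ne']; ring_nf
    have : 0 ≤ x * |Y| ^ lam := by positivity
    rw [h2]
    nlinarith
  · have : y ^ lam ≤ |Y| ^ lam := Real.rpow_le_rpow hy.le (h.trans (le_abs_self Y)) hl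
    have : x * y ^ lam ≤ x * |Y| ^ lam := by gcongr
    have : 0 < b * y := by positivity
    linarith

/-- contribution of a single ray -/
noncomputable def mmJ (ω : ℂ) (lam : ℝ) (mu : ℂ) (x : ℝ) : ℂ :=
  ∫ r in Set.Ioi (0 : ℝ), Complex.exp ((1 : ℂ) + r * ω) * ((1 : ℂ) + r * ω) ^ ((lam : ℂ) - mu)
    * Complex.exp (-(x * ((1 : ℂ) + r * ω) ^ (lam : ℂ)))

lemma mm_series (ω : ℂ) (h1 : ‖ω‖ = 1) (hre : ω.re < 0) (him : ω.im ≠ 0) (lam : ℝ)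
    (hl : 0 ≤ lam) (hl1 : lam < 1) (mu : ℂ) (x : ℝ) (hx : 0 ≤ x) :
    HasSum (fun n : ℕ => (-(x : ℂ)) ^ n / (n.factorial : ℂ)
      * mmR ω (-(mu - ((n : ℂ) + 1) * (lam : ℂ)))) (mmJ ω lam mu x) := by
  have hsl : ∀ r : ℝ, (1 : ℂ) + r * ω ∈ Complex.slitPlane := fun r => by
    simpa using mm_slit ω him 1 r (by simp) (by simp)
  have hne : ∀ r : ℝ, (1 : ℂ) + r * ω ≠ 0 := fun r => Complex.slitPlane_ne_zero (hsl r)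
  have hterm : ∀ (n : ℕ) (r : ℝ), ((1 : ℂ) + r * ω) ^ (-(mu - ((n : ℂ) + 1) * (lam : ℂ)))
      = ((1 : ℂ) + r * ω) ^ ((lam : ℂ) - mu) * (((1 : ℂ) + r * ω) ^ (lam : ℂ)) ^ n := fun n r => by
    rw [← Complex.cpow_nat_mul, ← Complex.cpow_add _ _ (hne r)]
    congr 1; ring
  have hnl : ∀ r : ℝ, ‖((1 : ℂ) + r * ω) ^ (lam : ℂ)‖ = ‖(1 : ℂ) + r * ω‖ ^ lam := fun r => by
    rw [Complex.norm_cpow_of_ne_zero (hne r)]; simp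
  have hexp : ∀ z : ℝ, HasSum (fun n : ℕ => z ^ n / (n.factorial : ℝ)) (Real.exp z) := fun z => by
    rw [Real.exp_eq_exp_ℝ]; exact NormedSpace.expSeries_div_hasSum_exp z
  have hexpc : ∀ z : ℂ, HasSum (fun n : ℕ => z ^ n / (n.factorial : ℂ)) (Complex.exp z) := fun z => by
    rw [Complex.exp_eq_exp_ℂ]; exact NormedSpace.expSeries_div_hasSum_exp z
  have hbs : ∀ r : ℝ, HasSum (fun n : ℕ =>
      ‖Complex.exp ((1 : ℂ) + r * ω) * ((1 : ℂ) + r * ω) ^ ((lam : ℂ) - mu)‖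
        * ((x * ‖(1 : ℂ) + r * ω‖ ^ lam) ^ n / (n.factorial : ℝ)))
      (‖Complex.exp ((1 : ℂ) + r * ω) * ((1 : ℂ) + r * ω) ^ ((lam : ℂ) - mu)‖
        * Real.exp (x * ‖(1 : ℂ) + r * ω‖ ^ lam)) := fun r => (hexp _).mul_left _
  have main := hasSum_integral_of_dominated_convergence (μ := volume.restrict (Set.Ioi (0:ℝ)))
    (F := fun (n : ℕ) (r : ℝ) => (-(x : ℂ)) ^ n / (n.factorial : ℂ) *
      (Complex.exp ((1 : ℂ) + r * ω) * ((1 : ℂ) + r * ω) ^ (-(mu - ((n : ℂ) + 1) * (lam : ℂ)))))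
    (f := fun r : ℝ => Complex.exp ((1 : ℂ) + r * ω) * ((1 : ℂ) + r * ω) ^ ((lam : ℂ) - mu)
      * Complex.exp (-(x * ((1 : ℂ) + r * ω) ^ (lam : ℂ))))
    (fun (n : ℕ) (r : ℝ) =>
      ‖Complex.exp ((1 : ℂ) + r * ω) * ((1 : ℂ) + r * ω) ^ ((lam : ℂ) - mu)‖
        * ((x * ‖(1 : ℂ) + r * ω‖ ^ lam) ^ n / (n.factorial : ℝ)))
    ?_ ?_ ?_ ?_ ?_
  · unfold mmJ mmR
    simpa only [integral_const_mul] using main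
  · intro n
    exact ((mm_ray_integrable ω h1 hre him _).const_mul _).aestronglyMeasurable
  · intro n
    refine Filter.Eventually.of_forall fun r => le_of_eq ?_
    simp only [hterm, norm_mul, norm_div, norm_pow, norm_neg, hnl, Complex.norm_real,
      Complex.norm_natCast, Real.norm_eq_abs, abs_of_nonneg hx, mul_pow]
    ring
  · exact Filter.Eventually.of_forall fun r => (hbs r).summable
  · simp only [(hbs _).tsum_eq]
    obtain ⟨C, hC, hb⟩ := mm_f_bound ω h1 hre ((lam : ℂ) - mu) |ω.im| (abs_pos.2 him)
    obtain ⟨B, hB⟩ := mm_sublinear lam x (-ω.re / 4) hl hl1 hx (by linarith)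
    refine Integrable.mono' (g := fun r : ℝ => C * Real.exp (B + -ω.re / 4) *
      Real.exp (-(-ω.re / 4) * r)) ?_ ?_ ?_
    · exact (exp_neg_integrableOn_Ioi 0 (by linarith)).const_mul _
    · refine (mm_ray_integrable ω h1 hre him _).norm.aestronglyMeasurable.mul ?_
      refine Continuous.aestronglyMeasurable ?_
      refine Real.continuous_exp.comp (continuous_const.mul ?_)
      refine Continuous.rpow_const (by fun_prop) fun r => Or.inr hl
    · refine (ae_restrict_mem measurableSet_Ioi).mono fun r hr => ?_
      have hr' : (0:ℝ) < r := hr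
      have b1 := hb 1 r zero_le_one le_rfl hr'.le (by simpa using hne r)
        (Or.inl (by simpa using mm_lower ω h1 r))
      simp only [Complex.ofReal_one] at b1
      have b2 := hB _ (norm_pos_iff.2 (hne r))
      have hn : ‖(1 : ℂ) + r * ω‖ ≤ 1 + r := by
        refine (norm_add_le _ _).trans ?_
        rw [norm_mul, h1]
        simp [abs_of_pos hr']
      have b3 : x * ‖(1 : ℂ) + r * ω‖ ^ lam ≤ B + -ω.re / 4 * (1 + r) := by
        nlinarith
      rw [norm_mul, norm_norm, Real.norm_eq_abs, Real.abs_exp]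
      calc _ ≤ (C * Real.exp (-(-ω.re / 2) * r)) * Real.exp (B + -ω.re / 4 * (1 + r)) := by gcongr
        _ = C * (Real.exp (-(-ω.re / 2) * r + (B + -ω.re / 4 * (1 + r)))) := by
          rw [mul_assoc, ← Real.exp_add]
        _ = C * (Real.exp ((B + -ω.re / 4) + -(-ω.re / 4) * r)) := by ring_nf
        _ = _ := by rw [Real.exp_add]; ring
  · refine Filter.Eventually.of_forall fun r => ?_
    have := (hexpc (-(x * ((1 : ℂ) + r * ω) ^ (lam : ℂ)))).mul_left
      (Complex.exp ((1 : ℂ) + r * ω) * ((1 : ℂ) + r * ω) ^ ((lam : ℂ) - mu))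
    refine this.congr_fun fun n => ?_
    simp only [hterm]
    rw [neg_mul_eq_neg_mul, mul_pow]
    ring

lemma mm_moment (ω : ℂ) (h1 : ‖ω‖ = 1) (hre : ω.re < 0) (him : ω.im ≠ 0) (lam η : ℝ) (hη : 0 < η)
    (hcone : ∀ r : ℝ, 0 ≤ r →
      |((1 : ℂ) + r * ω).arg| * lam < Real.pi / 2 ∧ η ≤ (((1 : ℂ) + r * ω) ^ (lam : ℂ)).re)
    (hl : 0 ≤ lam) (mu : ℂ) (a : ℝ) (ha : -1 < a) :
    IntegrableOn (fun x : ℝ => (x ^ a : ℝ) • mmJ ω lam mu x) (Set.Ioi 0) ∧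
    ∫ x in Set.Ioi (0 : ℝ), (x ^ a : ℝ) • mmJ ω lam mu x
      = Complex.Gamma ((a : ℂ) + 1) * mmR ω (-((lam : ℂ) * a + mu)) := by
  have hsl : ∀ r : ℝ, (1 : ℂ) + r * ω ∈ Complex.slitPlane := fun r => by
    simpa using mm_slit ω him 1 r (by simp) (by simp)
  have hne : ∀ r : ℝ, (1 : ℂ) + r * ω ≠ 0 := fun r => Complex.slitPlane_ne_zero (hsl r)
  have hFint : Integrable (Function.uncurry fun (x r : ℝ) => (x ^ a : ℝ) •
      (Complex.exp ((1 : ℂ) + r * ω) * ((1 : ℂ) + r * ω) ^ ((lam : ℂ) - mu)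
        * Complex.exp (-(x * ((1 : ℂ) + r * ω) ^ (lam : ℂ)))))
      ((volume.restrict (Set.Ioi (0:ℝ))).prod (volume.restrict (Set.Ioi (0:ℝ)))) := by
    have hg := Integrable.mul_prod (mm_integrable_rpow_exp a η ha hη)
      (mm_ray_integrable ω h1 hre him ((lam : ℂ) - mu)).norm
    rw [Measure.prod_restrict] at hg ⊢
    have hms : MeasurableSet (Set.Ioi (0:ℝ) ×ˢ Set.Ioi (0:ℝ)) :=
      measurableSet_Ioi.prod measurableSet_Ioi
    refine hg.mono' ?_ ?_
    · refine ContinuousOn.aestronglyMeasurable ?_ hms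
      simp only [Function.uncurry_def]
      refine ContinuousOn.smul (f := fun q : ℝ × ℝ => q.1 ^ a) (g := fun q : ℝ × ℝ =>
        Complex.exp ((1 : ℂ) + q.2 * ω) * ((1 : ℂ) + q.2 * ω) ^ ((lam : ℂ) - mu)
        * Complex.exp (-(q.1 * ((1 : ℂ) + q.2 * ω) ^ (lam : ℂ)))) ?_ ?_
      · exact ContinuousOn.rpow_const (by fun_prop) fun q hq => Or.inl (ne_of_gt hq.1)
      · have hcp : ∀ w : ℂ, ContinuousOn (fun q : ℝ × ℝ => ((1 : ℂ) + q.2 * ω) ^ w)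
            (Set.Ioi (0:ℝ) ×ˢ Set.Ioi (0:ℝ)) := fun w =>
          ContinuousOn.cpow_const (by fun_prop) fun q _ => hsl q.2
        refine ContinuousOn.mul (ContinuousOn.mul (by fun_prop) (hcp _)) ?_
        refine Complex.continuous_exp.comp_continuousOn ?_
        exact (ContinuousOn.mul (by fun_prop) (hcp _)).neg
    · refine (ae_restrict_mem hms).mono fun q hq => ?_
      have hq1 : (0:ℝ) < q.1 := hq.1
      have hq2 : (0:ℝ) < q.2 := hq.2
      simp only [Function.uncurry_def]
      rw [norm_smul, norm_mul _ (Complex.exp (-(_ * _))), Complex.norm_exp (-(_ * _)),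
        Real.norm_eq_abs, abs_of_nonneg (Real.rpow_nonneg hq1.le a)]
      have hc := (hcone q.2 hq2.le).2
      have e : (-((q.1 : ℂ) * ((1 : ℂ) + q.2 * ω) ^ (lam : ℂ))).re ≤ -η * q.1 := by
        simp only [Complex.neg_re, Complex.re_ofReal_mul]
        nlinarith
      calc _ = q.1 ^ a * Real.exp ((-((q.1 : ℂ) * ((1 : ℂ) + q.2 * ω) ^ (lam : ℂ))).re) *
            ‖Complex.exp ((1 : ℂ) + q.2 * ω) * ((1 : ℂ) + q.2 * ω) ^ ((lam : ℂ) - mu)‖ := by ring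
        _ ≤ _ := by gcongr
  have hJ : ∀ x : ℝ, (x ^ a : ℝ) • mmJ ω lam mu x = ∫ r in Set.Ioi (0 : ℝ), (x ^ a : ℝ) •
      (Complex.exp ((1 : ℂ) + r * ω) * ((1 : ℂ) + r * ω) ^ ((lam : ℂ) - mu)
        * Complex.exp (-(x * ((1 : ℂ) + r * ω) ^ (lam : ℂ)))) := fun x => by
    rw [integral_smul]; rfl
  simp only [hJ]
  refine ⟨hFint.integral_prod_left, ?_⟩
  rw [integral_integral_swap hFint]
  unfold mmR
  rw [← integral_const_mul]
  refine setIntegral_congr_fun measurableSet_Ioi fun r hr => ?_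
  have hr' : (0:ℝ) < r := hr
  obtain ⟨hc1, hc2⟩ := hcone r hr'.le
  have hlap := mm_laplace ((a : ℂ) + 1) (((1 : ℂ) + r * ω) ^ (lam : ℂ))
    (by simp; linarith) (by linarith)
  have e1 : ∀ x ∈ Set.Ioi (0:ℝ), (x ^ a : ℝ) •
      (Complex.exp ((1 : ℂ) + r * ω) * ((1 : ℂ) + r * ω) ^ ((lam : ℂ) - mu)
        * Complex.exp (-(x * ((1 : ℂ) + r * ω) ^ (lam : ℂ))))
      = (Complex.exp ((1 : ℂ) + r * ω) * ((1 : ℂ) + r * ω) ^ ((lam : ℂ) - mu)) *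
        ((x : ℂ) ^ ((a : ℂ) + 1 - 1) * Complex.exp (-(((1 : ℂ) + r * ω) ^ (lam : ℂ) * x))) := by
    intro x hx
    have hx' : (0:ℝ) < x := hx
    rw [Complex.real_smul, Complex.ofReal_cpow hx'.le, add_sub_cancel_right,
      mul_comm (x : ℂ) (((1 : ℂ) + r * ω) ^ (lam : ℂ))]
    ring
  rw [setIntegral_congr_fun measurableSet_Ioi e1, integral_const_mul, hlap]
  have him2 : (Complex.log ((1 : ℂ) + r * ω) * (-(lam : ℂ))).im = -(((1 : ℂ) + r * ω).arg * lam) := by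
    simp [Complex.log_im]
  have habs : |((1 : ℂ) + r * ω).arg * lam| < Real.pi / 2 := by
    rw [abs_mul, abs_of_nonneg hl]; exact hc1
  have habs2 := abs_lt.1 habs
  have hpi := Real.pi_pos
  have e2 : (1 / ((1 : ℂ) + r * ω) ^ (lam : ℂ)) ^ ((a : ℂ) + 1)
      = ((1 : ℂ) + r * ω) ^ (-(lam : ℂ) * ((a : ℂ) + 1)) := by
    rw [one_div, ← Complex.cpow_neg]
    rw [← Complex.cpow_mul]
    · rw [him2]; linarith
    · rw [him2]; linarith
  have e3 : ((1 : ℂ) + r * ω) ^ (-((lam : ℂ) * a + mu)) =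
      ((1 : ℂ) + r * ω) ^ ((lam : ℂ) - mu) * ((1 : ℂ) + r * ω) ^ (-(lam : ℂ) * ((a : ℂ) + 1)) := by
    rw [← Complex.cpow_add _ _ (hne r)]
    congr 1; ring
  rw [e2, e3]
  ring

/-- for `λ ∈ [0,1)`, `μ ∈ ℂ` and `a > −1`, the integral
`∫_0^∞ x^a · M_{λ,μ}(x) dx` converges and equals `Γ(a+1) / Γ(λ a + μ)`. -/
theorem mainardi_moment (lam : ℝ) (hlam : lam ∈ Set.Ico (0 : ℝ) 1) (mu : ℂ)
    (a : ℝ) (ha : -1 < a) :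
    IntegrableOn (fun x : ℝ => (x ^ a : ℝ) • mainardi lam mu (x : ℂ)) (Set.Ioi 0) ∧
    ∫ x in Set.Ioi (0 : ℝ), (x ^ a : ℝ) • mainardi lam mu (x : ℂ)
      = Complex.Gamma ((a : ℂ) + 1) / Complex.Gamma ((lam : ℂ) * (a : ℂ) + mu) := by
  obtain ⟨hl, hl1⟩ := hlam
  have hpi := Real.pi_pos
  set θ : ℝ := Real.pi * (2 / (3 + lam)) with hθ
  have hθ1 : Real.pi / 2 < θ := by
    have : (1:ℝ) / 2 < 2 / (3 + lam) := by
      rw [div_lt_div_iff₀ (by norm_num) (by linarith)]; linarith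
    rw [hθ]; nlinarith
  have hθ2 : θ < Real.pi := by
    have : 2 / (3 + lam) < 1 := by
      rw [div_lt_one (by linarith)]; linarith
    rw [hθ]; nlinarith
  have hlθ : lam * θ < Real.pi / 2 := by
    have : lam * (2 / (3 + lam)) < 1 / 2 := by
      rw [← mul_div_assoc, div_lt_div_iff₀ (by linarith) (by norm_num)]; linarith
    rw [hθ]; nlinarith
  obtain ⟨⟨a1, a2, a3, a4⟩, ⟨b1, b2, b3, b4⟩⟩ := mm_om θ hθ1 hθ2
  have hD := mmD_eq θ hθ1 hθ2
  unfold mmD at hD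
  generalize Complex.exp (θ * Complex.I) = ω at *
  generalize Complex.exp ((-θ : ℝ) * Complex.I) = ω' at *
  obtain ⟨η, hη, hcone⟩ := mm_cone ω a1 a2 a3 θ lam (by linarith) hθ2.le a4 hl hlθ
  obtain ⟨η', hη', hcone'⟩ := mm_cone ω' b1 b2 b3 θ lam (by linarith) hθ2.le b4 hl hlθ
  obtain ⟨i1, v1⟩ := mm_moment ω a1 a2 a3 lam η hη hcone hl mu a ha
  obtain ⟨i2, v2⟩ := mm_moment ω' b1 b2 b3 lam η' hη' hcone' hl mu a ha
  have hpiI : (2 * Real.pi * Complex.I : ℂ) ≠ 0 := Complex.two_pi_I_ne_zero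
  have hM : ∀ x ∈ Set.Ioi (0:ℝ), (x ^ a : ℝ) • mainardi lam mu (x : ℂ)
      = (ω / (2 * Real.pi * Complex.I)) * ((x ^ a : ℝ) • mmJ ω lam mu x)
        - (ω' / (2 * Real.pi * Complex.I)) * ((x ^ a : ℝ) • mmJ ω' lam mu x) := by
    intro x hx
    have s1 := (mm_series ω a1 a2 a3 lam hl hl1 mu x (le_of_lt hx)).mul_left
      (ω / (2 * Real.pi * Complex.I))
    have s2 := (mm_series ω' b1 b2 b3 lam hl hl1 mu x (le_of_lt hx)).mul_left
      (ω' / (2 * Real.pi * Complex.I))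
    have s3 := s1.sub s2
    have e : mainardi lam mu (x : ℂ) = ω / (2 * Real.pi * Complex.I) * mmJ ω lam mu x
        - ω' / (2 * Real.pi * Complex.I) * mmJ ω' lam mu x := by
      rw [← s3.tsum_eq]
      unfold mainardi
      congr 1
      funext n
      have h := hD (-(mu - ((n : ℂ) + 1) * (lam : ℂ)))
      rw [neg_neg] at h
      have h' : (Complex.Gamma (mu - ((n : ℂ) + 1) * (lam : ℂ)))⁻¹ =
          (ω * mmR ω (-(mu - ((n : ℂ) + 1) * (lam : ℂ)))
            - ω' * mmR ω' (-(mu - ((n : ℂ) + 1) * (lam : ℂ)))) / (2 * Real.pi * Complex.I) := by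
        rw [h, div_eq_mul_inv, div_eq_mul_inv]
        field_simp
      rw [div_eq_mul_inv, mul_inv, h']
      ring
    rw [e]
    simp only [Complex.real_smul]
    ring
  have j1 := i1.const_mul (ω / (2 * Real.pi * Complex.I))
  have j2 := i2.const_mul (ω' / (2 * Real.pi * Complex.I))
  refine ⟨IntegrableOn.congr_fun (j1.sub j2) (fun x hx => (hM x hx).symm) measurableSet_Ioi, ?_⟩
  rw [setIntegral_congr_fun measurableSet_Ioi hM, integral_sub j1 j2, integral_const_mul,
    integral_const_mul, v1, v2]
  have h := hD (-((lam : ℂ) * a + mu))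
  rw [neg_neg] at h
  have h' : (Complex.Gamma ((lam : ℂ) * a + mu))⁻¹ =
      (ω * mmR ω (-((lam : ℂ) * a + mu))
        - ω' * mmR ω' (-((lam : ℂ) * a + mu))) / (2 * Real.pi * Complex.I) := by
    rw [h, div_eq_mul_inv, div_eq_mul_inv]
    field_simp
  rw [div_eq_mul_inv (Complex.Gamma _), h']
  ring
end

section
/- Let 0 < α < 1 and β ≥ α. Then E_{α,β}(−x^α) > 0 for all x ≥ 0, and there exists a finite constant C_{α,β} > 0 such that E_{α,β}(−x^α) ≤ C_{α,β} / (1 + x^α) for all x ≥ 0. -/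
/-- The two-parameter Mittag-Leffler function `E_{α,β}(z) = ∑ z^k / Γ(α k + β)`. -/
noncomputable def mittagLeffler (α b : ℝ) (z : ℝ) : ℝ :=
  ∑' k : ℕ, z ^ k / Real.Gamma (α * (k : ℝ) + b)

open Real MeasureTheory Set Filter Topology

lemma ml_gamma_ratio {a s : ℝ} (ha : 0 < a) (ha1 : a < 1) (hs : 0 < s + a - 1) :
    (s + a - 1) ^ a * Real.Gamma s ≤ Real.Gamma (s + a) := by
  have h := Real.Gamma_mul_add_mul_le_rpow_Gamma_mul_rpow_Gamma (s := s + a - 1) (t := s + a)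
    (a := a) (b := 1 - a) hs (by linarith) ha (by linarith) (by ring)
  have e1 : a * (s + a - 1) + (1 - a) * (s + a) = s := by ring
  rw [e1] at h
  have e2 : Real.Gamma (s + a) = (s + a - 1) * Real.Gamma (s + a - 1) := by
    rw [← Real.Gamma_add_one hs.ne']; congr 1; ring
  have g1 := Real.Gamma_pos_of_pos hs
  have g2 : 0 < Real.Gamma (s + a) := Real.Gamma_pos_of_pos (by linarith)
  calc (s + a - 1) ^ a * Real.Gamma s
      ≤ (s + a - 1) ^ a * (Real.Gamma (s + a - 1) ^ a * Real.Gamma (s + a) ^ (1 - a)) := by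
        gcongr
    _ = Real.Gamma (s + a) ^ a * Real.Gamma (s + a) ^ (1 - a) := by
        rw [← mul_assoc, ← Real.mul_rpow hs.le g1.le, ← e2]
    _ = Real.Gamma (s + a) := by
        rw [← Real.rpow_add g2]; simp

lemma ml_summable {a b : ℝ} (ha : 0 < a) (ha1 : a < 1) (hb : 0 < b) (z : ℝ) :
    Summable (fun k : ℕ => z ^ k / Real.Gamma (a * (k : ℝ) + b)) := by
  refine summable_of_ratio_norm_eventually_le (r := 1 / 2) (by norm_num) ?_
  have T : Tendsto (fun k : ℕ => a * (k : ℝ) + b + a - 1) atTop atTop := by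
    have : Tendsto (fun k : ℕ => a * (k : ℝ) + (b + a - 1)) atTop atTop :=
      tendsto_atTop_add_const_right _ _
        (Tendsto.const_mul_atTop ha tendsto_natCast_atTop_atTop)
    refine this.congr (fun k => by ring)
  have T2 := (tendsto_rpow_atTop ha).comp T
  filter_upwards [T.eventually_gt_atTop 0, T2.eventually_ge_atTop (2 * |z|)] with k h1 h2
  simp only [Function.comp] at h2
  have hk : 0 < a * (k : ℝ) + b := by positivity
  have g := ml_gamma_ratio ha ha1 h1
  have g0 := Real.Gamma_pos_of_pos hk
  have g2 : 0 < Real.Gamma (a * (k : ℝ) + b + a) := Real.Gamma_pos_of_pos (by linarith)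
  have e : a * ((k + 1 : ℕ) : ℝ) + b = a * (k : ℝ) + b + a := by push_cast; ring
  rw [e, norm_div, norm_div, norm_pow, norm_pow, Real.norm_of_nonneg g0.le,
    Real.norm_of_nonneg g2.le, Real.norm_eq_abs, div_le_iff₀ g2]
  have : 2 * |z| * Real.Gamma (a * (k : ℝ) + b) ≤ Real.Gamma (a * (k : ℝ) + b + a) :=
    le_trans (by gcongr) g
  calc |z| ^ (k + 1) = 1 / 2 * (|z| ^ k / Real.Gamma (a * (k : ℝ) + b)) *
        (2 * |z| * Real.Gamma (a * (k : ℝ) + b)) := by field_simp; ring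
    _ ≤ _ := by gcongr

lemma ml_rec {a b : ℝ} (ha : 0 < a) (ha1 : a < 1) (hb : 0 < b) (z : ℝ) :
    mittagLeffler a b z = 1 / Real.Gamma b + z * mittagLeffler a (b + a) z := by
  unfold mittagLeffler
  rw [(ml_summable ha ha1 hb z).tsum_eq_zero_add, ← tsum_mul_left]
  simp only [pow_zero, Nat.cast_zero, mul_zero, zero_add]
  congr 1
  refine tsum_congr fun k => ?_
  have e : a * ((k + 1 : ℕ) : ℝ) + b = a * (k : ℝ) + (b + a) := by push_cast; ring
  rw [e, pow_succ]; ring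

lemma ml_zero {a b : ℝ} (ha : 0 < a) (ha1 : a < 1) (hb : 0 < b) :
    mittagLeffler a b 0 = 1 / Real.Gamma b := by
  rw [ml_rec ha ha1 hb]; simp

lemma ml_continuous {a b : ℝ} (ha : 0 < a) (ha1 : a < 1) (hb : 0 < b) :
    Continuous (mittagLeffler a b) := by
  rw [continuous_iff_continuousAt]
  intro z
  have : ContinuousOn (mittagLeffler a b) (Metric.ball 0 (|z| + 1)) := by
    unfold mittagLeffler
    refine continuousOn_tsum (u := fun k : ℕ => (|z| + 1) ^ k / Real.Gamma (a * (k : ℝ) + b))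
      (fun k => by fun_prop) (ml_summable ha ha1 hb _) ?_
    intro k x hx
    have hk : 0 < a * (k : ℝ) + b := by positivity
    have g0 := Real.Gamma_pos_of_pos hk
    rw [norm_div, norm_pow, Real.norm_of_nonneg g0.le]
    have : ‖x‖ ≤ |z| + 1 := by simpa using (mem_ball_zero_iff.1 hx).le
    gcongr
  exact this.continuousAt (Metric.isOpen_ball.mem_nhds (by simp))

lemma ml_continuous' {a b : ℝ} (ha : 0 < a) (ha1 : a < 1) (hb : 0 < b) :
    Continuous (fun s : ℝ => mittagLeffler a b (-(s ^ a))) :=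
  (ml_continuous ha ha1 hb).comp (Real.continuous_rpow_const ha.le).neg

lemma ml_beta {u v t : ℝ} (hu : 0 < u) (hv : 0 < v) (ht : 0 < t) :
    ∫ s in (0:ℝ)..t, s ^ (u - 1) * (t - s) ^ (v - 1) =
      t ^ (u + v - 1) * (Real.Gamma u * Real.Gamma v / Real.Gamma (u + v)) := by
  have h := Complex.betaIntegral_scaled (u : ℂ) (v : ℂ) ht
  rw [Complex.betaIntegral_eq_Gamma_mul_div _ _ (by simpa) (by simpa), ← Complex.ofReal_add,
    Complex.Gamma_ofReal, Complex.Gamma_ofReal, Complex.Gamma_ofReal] at h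
  have e : ∫ x in (0:ℝ)..t, (x : ℂ) ^ ((u : ℂ) - 1) * ((t : ℂ) - x) ^ ((v : ℂ) - 1) =
      ∫ x in (0:ℝ)..t, ((x ^ (u - 1) * (t - x) ^ (v - 1) : ℝ) : ℂ) := by
    refine intervalIntegral.integral_congr fun x hx => ?_
    rw [uIcc_of_le ht.le] at hx
    rw [Complex.ofReal_mul, Complex.ofReal_cpow hx.1, Complex.ofReal_cpow (by linarith [hx.2])]
    push_cast; rfl
  rw [e, intervalIntegral.integral_ofReal] at h
  have e2 : (t : ℂ) ^ (((u + v : ℝ) : ℂ) - 1) = ((t ^ (u + v - 1) : ℝ) : ℂ) := by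
    rw [Complex.ofReal_cpow ht.le]; push_cast; rfl
  rw [e2] at h
  exact_mod_cast h

lemma ml_beta_int {u v t : ℝ} (hu : 0 < u) (hv : 0 < v) (ht : 0 < t) :
    IntervalIntegrable (fun s : ℝ => s ^ (u - 1) * (t - s) ^ (v - 1)) volume 0 t := by
  by_contra hc
  have := intervalIntegral.integral_undef hc
  rw [ml_beta hu hv ht] at this
  have h1 := Real.Gamma_pos_of_pos hu
  have h2 := Real.Gamma_pos_of_pos hv
  have h3 := Real.Gamma_pos_of_pos (add_pos hu hv)
  have : 0 < t ^ (u + v - 1) * (Real.Gamma u * Real.Gamma v / Real.Gamma (u + v)) := by positivity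
  linarith

lemma ml_conv_int {a b c t : ℝ} (ha : 0 < a) (ha1 : a < 1) (hb : 0 < b) (hc : 0 < c)
    (ht : 0 < t) :
    IntervalIntegrable (fun s : ℝ => s ^ (b - 1) * (t - s) ^ (c - 1) *
      mittagLeffler a b (-(s ^ a))) volume 0 t :=
  (ml_beta_int hb hc ht).mul_continuousOn (ml_continuous' ha ha1 hb).continuousOn

lemma ml_conv {a b c t : ℝ} (ha : 0 < a) (ha1 : a < 1) (hb : 0 < b) (hc : 0 < c)
    (ht : 0 < t) :
    ∫ s in (0:ℝ)..t, s ^ (b - 1) * (t - s) ^ (c - 1) * mittagLeffler a b (-(s ^ a)) =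
      Real.Gamma c * t ^ (b + c - 1) * mittagLeffler a (b + c) (-(t ^ a)) := by
  let F : ℕ → ℝ → ℝ := fun k s => (-1) ^ k / Real.Gamma (a * (k : ℝ) + b) *
    (s ^ (a * (k : ℝ) + b - 1) * (t - s) ^ (c - 1))
  have hk : ∀ k : ℕ, 0 < a * (k : ℝ) + b := fun k => by positivity
  have hG : ∀ k : ℕ, 0 < Real.Gamma (a * (k : ℝ) + b) := fun k => Real.Gamma_pos_of_pos (hk k)
  have hpw : ∀ k : ℕ, t ^ (a * (k : ℝ) + b + c - 1) = (t ^ a) ^ k * t ^ (b + c - 1) := by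
    intro k
    rw [← Real.rpow_natCast, ← Real.rpow_mul ht.le, ← Real.rpow_add ht]; congr 1; ring
  have hFint : ∀ k, Integrable (F k) (volume.restrict (Ioc 0 t)) := fun k =>
    ((intervalIntegrable_iff_integrableOn_Ioc_of_le ht.le).1
      (ml_beta_int (hk k) hc ht)).const_mul _
  have hB : ∀ k : ℕ, ∫ s in Ioc 0 t, s ^ (a * (k : ℝ) + b - 1) * (t - s) ^ (c - 1) =
      Real.Gamma (a * (k : ℝ) + b) * (Real.Gamma c * t ^ (b + c - 1) *
        ((t ^ a) ^ k / Real.Gamma (a * (k : ℝ) + (b + c)))) := by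
    intro k
    rw [← intervalIntegral.integral_of_le ht.le, ml_beta (hk k) hc ht, hpw k, ← add_assoc]
    ring
  have hI : ∀ k, ∫ s in Ioc 0 t, F k s = Real.Gamma c * t ^ (b + c - 1) *
      ((-(t ^ a)) ^ k / Real.Gamma (a * (k : ℝ) + (b + c))) := by
    intro k
    simp only [F]
    rw [integral_const_mul, hB k, neg_pow (t ^ a)]
    have := (hG k).ne'
    field_simp
  have hN : ∀ k, ∫ s in Ioc 0 t, ‖F k s‖ = Real.Gamma c * t ^ (b + c - 1) *
      ((t ^ a) ^ k / Real.Gamma (a * (k : ℝ) + (b + c))) := by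
    intro k
    have : ∫ s in Ioc 0 t, ‖F k s‖ = ∫ s in Ioc 0 t, 1 / Real.Gamma (a * (k : ℝ) + b) *
        (s ^ (a * (k : ℝ) + b - 1) * (t - s) ^ (c - 1)) := by
      refine setIntegral_congr_fun measurableSet_Ioc fun s hs => ?_
      simp only [F]
      rw [norm_mul, norm_div, norm_pow, norm_neg, norm_one, one_pow,
        Real.norm_of_nonneg (hG k).le, Real.norm_of_nonneg]
      exact mul_nonneg (Real.rpow_nonneg hs.1.le _) (Real.rpow_nonneg (by linarith [hs.2]) _)
    rw [this, integral_const_mul, hB k]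
    have := (hG k).ne'
    field_simp
  have hS := hasSum_integral_of_summable_integral_norm hFint (by
    simp_rw [hN]
    exact (ml_summable ha ha1 (add_pos hb hc) _).mul_left _)
  have h1 := hS.tsum_eq
  simp_rw [hI] at h1
  rw [tsum_mul_left] at h1
  rw [intervalIntegral.integral_of_le ht.le]
  refine Eq.trans ?_ h1.symm
  refine setIntegral_congr_fun measurableSet_Ioc fun s hs => ?_
  simp only [F, mittagLeffler]
  rw [← tsum_mul_left]
  refine tsum_congr fun k => ?_
  have : s ^ (a * (k : ℝ) + b - 1) = (s ^ a) ^ k * s ^ (b - 1) := by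
    rw [← Real.rpow_natCast, ← Real.rpow_mul hs.1.le, ← Real.rpow_add hs.1]; congr 1; ring
  rw [this, neg_pow (s ^ a)]
  ring

/-- Renewal identity. -/
lemma ml_renewal {a t : ℝ} (ha : 0 < a) (ha1 : a < 1) (ht : 0 < t) :
    ∫ s in (0:ℝ)..t, s ^ (a - 1) * (t - s) ^ (a - 1) * mittagLeffler a a (-(s ^ a)) =
      t ^ (a - 1) * (1 - Real.Gamma a * mittagLeffler a a (-(t ^ a))) := by
  rw [ml_conv ha ha1 ha ha ht, ml_rec ha ha1 ha]
  have e : t ^ (a + a - 1) = t ^ (a - 1) * t ^ a := by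
    rw [← Real.rpow_add ht]; congr 1; ring
  have := (Real.Gamma_pos_of_pos ha).ne'
  rw [e]; field_simp; ring

lemma ml_pos_diag {a : ℝ} (ha : 0 < a) (ha1 : a < 1) {T : ℝ} (hT : 0 ≤ T) :
    0 < mittagLeffler a a (-(T ^ a)) := by
  by_contra hneg
  push Not at hneg
  set φ : ℝ → ℝ := fun s => mittagLeffler a a (-(s ^ a)) with hφ
  have hc : Continuous φ := ml_continuous' ha ha1 ha
  have hΓ := Real.Gamma_pos_of_pos ha
  -- first zero
  let S : Set ℝ := Ici 0 ∩ φ ⁻¹' Iic 0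
  have hSc : IsClosed S := isClosed_Ici.inter (isClosed_Iic.preimage hc)
  have hSn : S.Nonempty := ⟨T, hT, hneg⟩
  have hSb : BddBelow S := ⟨0, fun x hx => hx.1⟩
  obtain ⟨h0, h1⟩ := hSc.csInf_mem hSn hSb
  set t0 := sInf S with ht0def
  have hlt : ∀ s, 0 ≤ s → s < t0 → 0 < φ s := by
    intro s hs hst
    by_contra hcon
    exact absurd (csInf_le hSb (show s ∈ S from ⟨hs, not_lt.1 hcon⟩)) (not_le.2 hst)
  have h1 : φ t0 ≤ 0 := h1
  have ht0 : 0 < t0 := by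
    rcases (show (0:ℝ) ≤ t0 from h0).eq_or_lt with h | h
    · rw [← h] at h1
      simp only [hφ, Real.zero_rpow ha.ne', neg_zero, ml_zero ha ha1 ha] at h1
      have : 0 < 1 / Real.Gamma a := by positivity
      linarith
    · exact h
  -- choice of left endpoint
  have hev : ∀ᶠ t in 𝓝 t0, (t0 - t) ^ a / a - Real.Gamma a * (t0 / t) ^ (a - 1) < 0 := by
    have hcont : ContinuousAt
        (fun t => (t0 - t) ^ a / a - Real.Gamma a * (t0 / t) ^ (a - 1)) t0 := by
      refine ContinuousAt.sub (ContinuousAt.div_const ?_ _) (ContinuousAt.mul continuousAt_const ?_)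
      · exact ContinuousAt.rpow_const (by fun_prop) (Or.inr ha.le)
      · exact ContinuousAt.rpow_const (ContinuousAt.div continuousAt_const continuousAt_id ht0.ne')
          (Or.inl (by simp [ht0.ne']))
    refine hcont.eventually_lt continuousAt_const ?_
    simp [ha.ne', ht0.ne', Real.zero_rpow, hΓ]
  obtain ⟨ε, hε, hball⟩ := Metric.eventually_nhds_iff.1 hev
  obtain ⟨t1, ht1a, ht1b⟩ := exists_between (max_lt (sub_lt_self t0 hε) ht0)
  have ht1 : 0 < t1 := (le_max_right _ _).trans_lt ht1a
  have ht1ε : t0 - ε < t1 := (le_max_left _ _).trans_lt ht1a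
  set e : ℝ → ℝ := fun s => s ^ (a - 1) * φ s with he
  have hec : ContinuousOn e (Icc t1 t0) := by
    refine ContinuousOn.mul (fun s hs => ?_) hc.continuousOn
    exact (Real.continuousAt_rpow_const _ _ (Or.inl (by linarith [hs.1]))).continuousWithinAt
  obtain ⟨t, ht, hmax⟩ := isCompact_Icc.exists_isMaxOn ⟨t1, left_mem_Icc.2 ht1b.le⟩ hec
  have htpos : 0 < t := ht1.trans_le ht.1
  have het : 0 < e t := lt_of_lt_of_le
    (mul_pos (Real.rpow_pos_of_pos ht1 _) (hlt t1 ht1.le ht1b)) (hmax (left_mem_Icc.2 ht1b.le))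
  have htt0 : t < t0 := by
    refine lt_of_le_of_ne ht.2 fun h => ?_
    rw [h] at het
    have : e t0 ≤ 0 := mul_nonpos_of_nonneg_of_nonpos (Real.rpow_nonneg ht0.le _) h1
    linarith
  have hkey := hball (y := t) (by
    rw [Real.dist_eq, abs_lt]; constructor <;> linarith [ht.1, ht.2])
  have R0 := ml_renewal ha ha1 ht0
  have R1 := ml_renewal ha ha1 htpos
  have I0 := ml_conv_int ha ha1 ha ha ht0
  have I1 := ml_conv_int ha ha1 ha ha htpos
  have I0a : IntervalIntegrable (fun s : ℝ => s ^ (a - 1) * (t0 - s) ^ (a - 1) *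
      mittagLeffler a a (-(s ^ a))) volume 0 t :=
    I0.mono_set (by rw [uIcc_of_le htpos.le, uIcc_of_le ht0.le]; exact Icc_subset_Icc_right htt0.le)
  have I0b : IntervalIntegrable (fun s : ℝ => s ^ (a - 1) * (t0 - s) ^ (a - 1) *
      mittagLeffler a a (-(s ^ a))) volume t t0 :=
    I0.mono_set (by rw [uIcc_of_le htt0.le, uIcc_of_le ht0.le]; exact Icc_subset_Icc_left htpos.le)
  have A := intervalIntegral.integral_mono_on_of_le_Ioo htpos.le I0a
    (I1.const_mul ((t0 / t) ^ (a - 1))) (by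
      intro s hs
      have hφs : 0 < mittagLeffler a a (-(s ^ a)) := hlt s hs.1.le (hs.2.trans htt0)
      have h3 : (t0 - s) ^ (a - 1) ≤ (t0 / t) ^ (a - 1) * (t - s) ^ (a - 1) := by
        have hts : 0 < t - s := by linarith [hs.2]
        rw [← Real.mul_rpow (by positivity) hts.le]
        refine Real.rpow_le_rpow_of_nonpos (by positivity) ?_ (by linarith)
        rw [div_mul_eq_mul_div, div_le_iff₀ htpos]
        nlinarith [hs.1]
      have h4 : 0 ≤ s ^ (a - 1) := Real.rpow_nonneg hs.1.le _
      calc s ^ (a - 1) * (t0 - s) ^ (a - 1) * mittagLeffler a a (-(s ^ a))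
          ≤ s ^ (a - 1) * ((t0 / t) ^ (a - 1) * (t - s) ^ (a - 1)) *
            mittagLeffler a a (-(s ^ a)) := by gcongr
        _ = _ := by ring)
  rw [intervalIntegral.integral_const_mul, R1] at A
  have J : IntervalIntegrable (fun s : ℝ => (t0 - s) ^ (a - 1)) volume t t0 := by
    have := (intervalIntegral.intervalIntegrable_rpow' (a := 0) (b := t0 - t)
      (r := a - 1) (by linarith)).comp_sub_left t0
    simpa using this.symm
  have B := intervalIntegral.integral_mono_on_of_le_Ioo htt0.le I0b
    (J.const_mul (e t)) (by
      intro s hs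
      have h5 : e s ≤ e t := hmax ⟨ht.1.trans hs.1.le, hs.2.le⟩
      have h6 : 0 ≤ (t0 - s) ^ (a - 1) := Real.rpow_nonneg (by linarith [hs.2]) _
      calc s ^ (a - 1) * (t0 - s) ^ (a - 1) * mittagLeffler a a (-(s ^ a))
          = e s * (t0 - s) ^ (a - 1) := by simp only [he, hφ]; ring
        _ ≤ _ := by gcongr)
  have K : ∫ s in t..t0, (t0 - s) ^ (a - 1) = (t0 - t) ^ a / a := by
    rw [intervalIntegral.integral_comp_sub_left (fun x => x ^ (a - 1)) t0, sub_self,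
      integral_rpow (Or.inl (by linarith))]
    simp [Real.zero_rpow ha.ne']
  rw [intervalIntegral.integral_const_mul, K] at B
  have hsum := intervalIntegral.integral_add_adjacent_intervals I0a I0b
  rw [R0] at hsum
  have hd : (t0 / t) ^ (a - 1) * t ^ (a - 1) = t0 ^ (a - 1) := by
    rw [← Real.mul_rpow (by positivity) htpos.le, div_mul_cancel₀ _ htpos.ne']
  have hp : t0 ^ (a - 1) ≤ t0 ^ (a - 1) * (1 - Real.Gamma a * mittagLeffler a a (-(t0 ^ a))) := by
    have h7 : 0 ≤ t0 ^ (a - 1) := Real.rpow_nonneg ht0.le _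
    have h8 : Real.Gamma a * φ t0 ≤ 0 := mul_nonpos_of_nonneg_of_nonpos hΓ.le h1
    simp only [hφ] at h8
    nlinarith
  have hA : (t0 / t) ^ (a - 1) * (t ^ (a - 1) *
      (1 - Real.Gamma a * mittagLeffler a a (-(t ^ a)))) =
      t0 ^ (a - 1) - Real.Gamma a * (t0 / t) ^ (a - 1) * e t := by
    rw [← hd]; simp only [he, hφ]; ring
  rw [hA] at A
  have hfin := mul_neg_of_pos_of_neg het hkey
  nlinarith

lemma ml_pos {a b : ℝ} (ha : 0 < a) (ha1 : a < 1) (hab : a ≤ b) {x : ℝ} (hx : 0 ≤ x) :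
    0 < mittagLeffler a b (-(x ^ a)) := by
  have hb : 0 < b := ha.trans_le hab
  rcases hx.eq_or_lt with rfl | hx
  · rw [Real.zero_rpow ha.ne', neg_zero, ml_zero ha ha1 hb]
    have := Real.Gamma_pos_of_pos hb
    positivity
  rcases hab.eq_or_lt with rfl | hab
  · exact ml_pos_diag ha ha1 hx.le
  have hc : 0 < b - a := by linarith
  have h := ml_conv ha ha1 ha hc hx
  have hI : 0 < ∫ s in (0:ℝ)..x, s ^ (a - 1) * (x - s) ^ (b - a - 1) *
      mittagLeffler a a (-(s ^ a)) := by
    refine intervalIntegral.intervalIntegral_pos_of_pos_on (ml_conv_int ha ha1 ha hc hx)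
      (fun s hs => ?_) hx
    exact mul_pos (mul_pos (Real.rpow_pos_of_pos hs.1 _)
      (Real.rpow_pos_of_pos (by linarith [hs.2]) _)) (ml_pos_diag ha ha1 hs.1.le)
  rw [h, add_sub_cancel] at hI
  have h1 := Real.Gamma_pos_of_pos hc
  exact pos_of_mul_pos_right hI (mul_nonneg h1.le (Real.rpow_nonneg hx.le _))

lemma ml_shift {a b : ℝ} (ha : 0 < a) (ha1 : a < 1) (hb : 0 < b) {x : ℝ} (hx : 0 ≤ x) :
    mittagLeffler a b (-(x ^ a)) ≤ b * mittagLeffler a (b + 1) (-(x ^ a)) := by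
  have hG := Real.Gamma_pos_of_pos hb
  have hG1 := Real.Gamma_add_one hb.ne'
  rcases hx.eq_or_lt with rfl | hx
  · rw [Real.zero_rpow ha.ne', neg_zero, ml_zero ha ha1 hb, ml_zero ha ha1 (by linarith), hG1]
    apply le_of_eq
    field_simp
  have hb1 : 0 < b + 1 := by linarith
  have A := intervalIntegral.integral_mono_on_of_le_Ioo hx.le (ml_conv_int ha ha1 ha hb1 hx)
    ((ml_conv_int ha ha1 ha hb hx).const_mul x) (by
      intro s hs
      have h1 : 0 < x - s := by linarith [hs.2]
      have h2 : (x - s) ^ (b + 1 - 1) = (x - s) * (x - s) ^ (b - 1) := by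
        rw [mul_comm, ← Real.rpow_add_one h1.ne']; congr 1; ring
      have h3 := ml_pos_diag ha ha1 hs.1.le
      have h4 := Real.rpow_nonneg hs.1.le (a - 1)
      have h5 := Real.rpow_nonneg h1.le (b - 1)
      have h6 : x - s ≤ x := by linarith [hs.1]
      rw [h2]
      calc s ^ (a - 1) * ((x - s) * (x - s) ^ (b - 1)) * mittagLeffler a a (-(s ^ a))
          ≤ s ^ (a - 1) * (x * (x - s) ^ (b - 1)) * mittagLeffler a a (-(s ^ a)) := by gcongr
        _ = _ := by ring)
  rw [intervalIntegral.integral_const_mul, ml_conv ha ha1 ha hb1 hx, ml_conv ha ha1 ha hb hx,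
    hG1] at A
  have e1 : x ^ (a + (b + 1) - 1) = x * x ^ (a + b - 1) := by
    rw [mul_comm, ← Real.rpow_add_one hx.ne']; congr 1; ring
  rw [e1] at A
  have hpos : 0 < Real.Gamma b * (x * x ^ (a + b - 1)) := by positivity
  have B : b * mittagLeffler a (a + (b + 1)) (-(x ^ a)) ≤ mittagLeffler a (a + b) (-(x ^ a)) := by
    refine le_of_mul_le_mul_left ?_ hpos
    linarith
  have r1 := ml_rec ha ha1 hb (-(x ^ a))
  have r2 := ml_rec ha ha1 hb1 (-(x ^ a))
  rw [hG1] at r2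
  rw [add_comm a, add_comm a] at B
  have e3 : b * (1 / (b * Real.Gamma b)) = 1 / Real.Gamma b := by field_simp
  have hxa : 0 ≤ x ^ a := by positivity
  have := mul_le_mul_of_nonneg_left B hxa
  rw [r1, r2, mul_add, e3]
  linarith

/-- for `0 < α < 1` and `β ≥ α`, `E_{α,β}(−x^α) > 0` for all `x ≥ 0`,
and there is a finite constant `C > 0` with `E_{α,β}(−x^α) ≤ C / (1 + x^α)` for all `x ≥ 0`. -/
theorem mittagLeffler_pos_and_bound (α β : ℝ) (hα : 0 < α) (hα1 : α < 1) (hβ : α ≤ β) :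
    (∀ x : ℝ, 0 ≤ x → 0 < mittagLeffler α β (-(x ^ α))) ∧
    ∃ C : ℝ, 0 < C ∧ ∀ x : ℝ, 0 ≤ x →
      mittagLeffler α β (-(x ^ α)) ≤ C / (1 + x ^ α) := by
  refine ⟨fun x hx => ml_pos hα hα1 hβ hx, ?_⟩
  have hb : 0 < β := hα.trans_le hβ
  have hc : 0 < β + 1 - α := by linarith
  have g1 : 0 < Real.Gamma (β + 1) := Real.Gamma_pos_of_pos (by linarith)
  have g2 := Real.Gamma_pos_of_pos hc
  refine ⟨β * (1 / Real.Gamma (β + 1) + 1 / Real.Gamma (β + 1 - α)), by positivity, ?_⟩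
  intro x hx
  have hy : 0 ≤ x ^ α := Real.rpow_nonneg hx _
  rw [le_div_iff₀ (by linarith)]
  have s := ml_shift hα hα1 hb hx
  have r1 := ml_rec hα hα1 (show 0 < β + 1 by linarith) (-(x ^ α))
  have p1 := ml_pos hα hα1 (show α ≤ β + 1 + α by linarith) hx
  have key1 : mittagLeffler α (β + 1) (-(x ^ α)) ≤ 1 / Real.Gamma (β + 1) := by
    have := mul_nonneg hy p1.le
    linarith
  have key2 : x ^ α * mittagLeffler α (β + 1) (-(x ^ α)) ≤ 1 / Real.Gamma (β + 1 - α) := by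
    have r2 := ml_rec hα hα1 hc (-(x ^ α))
    rw [sub_add_cancel] at r2
    by_cases h : α ≤ β + 1 - α
    · have := ml_pos hα hα1 h hx
      linarith
    · exfalso; linarith
  calc mittagLeffler α β (-(x ^ α)) * (1 + x ^ α)
      ≤ (β * mittagLeffler α (β + 1) (-(x ^ α))) * (1 + x ^ α) := by gcongr
    _ = β * (mittagLeffler α (β + 1) (-(x ^ α)) +
        x ^ α * mittagLeffler α (β + 1) (-(x ^ α))) := by ring
    _ ≤ _ := by gcongr
end

section
/- Fix β ∈ (0,2], t, s > 0 and x ∈ ℝ. Then the convolution of the exponential reference kernels satisfies ∫_ℝ 𝒢_{e,β}(t, x−y) · 𝒢_{e,β}(s, y) dy ≤ Ĉ_β · 𝒢_{e,β}(t+s, x), where Ĉ_β = (2^{β/2} / (2^{β/2} − 1)) · exp(−2^{−β/2}). -/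
open MeasureTheory

/-- The exponential reference kernel `𝒢_{e,β}(t,x) = (1/(2 t^{β/2})) exp(−|x|/t^{β/2})`. -/
noncomputable def expKernel (β t x : ℝ) : ℝ :=
  1 / (2 * t ^ (β / 2)) * Real.exp (-|x| / t ^ (β / 2))

lemma aux_conv (p q x : ℝ) (hp : 0 < p) (hq : 0 < q) (hx : 0 ≤ x) :
    ∫ y : ℝ, Real.exp (-(p * |x - y|)) * Real.exp (-(q * |y|)) =
      Real.exp (-(p * x)) / (p + q) + (∫ y in (0:ℝ)..x, Real.exp (-(p * x)) * Real.exp ((p - q) * y))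
        + Real.exp (-(q * x)) / (p + q) := by
  have hpq : 0 < p + q := by linarith
  set f : ℝ → ℝ := fun y => Real.exp (-(p * |x - y|)) * Real.exp (-(q * |y|)) with hf
  have e1 : Set.EqOn f (fun y => Real.exp (-(p * x)) * Real.exp ((p + q) * y)) (Set.Iic 0) := by
    intro y hy
    have hy' : y ≤ 0 := hy
    simp only [hf]
    rw [abs_of_nonneg (by linarith : 0 ≤ x - y), abs_of_nonpos hy', ← Real.exp_add, ← Real.exp_add]
    congr 1; ring
  have e2 : Set.EqOn f (fun y => Real.exp (-(p * x)) * Real.exp ((p - q) * y)) (Set.Ioc 0 x) := by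
    intro y hy
    simp only [hf]
    rw [abs_of_nonneg (by linarith [hy.2] : 0 ≤ x - y), abs_of_nonneg hy.1.le, ← Real.exp_add,
      ← Real.exp_add]
    congr 1; ring
  have e3 : Set.EqOn f (fun y => Real.exp (p * x) * Real.exp (-(p + q) * y)) (Set.Ioi x) := by
    intro y hy
    have hy' : x < y := hy
    simp only [hf]
    rw [abs_of_nonpos (by linarith : x - y ≤ 0), abs_of_nonneg (by linarith : 0 ≤ y),
      ← Real.exp_add, ← Real.exp_add]
    congr 1; ring
  have i1 : IntegrableOn f (Set.Iic 0) :=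
    IntegrableOn.congr_fun ((integrableOn_exp_mul_Iic hpq 0).const_mul _) e1.symm measurableSet_Iic
  have i3 : IntegrableOn f (Set.Ioi x) :=
    IntegrableOn.congr_fun ((integrableOn_exp_mul_Ioi (by linarith : -(p + q) < 0) x).const_mul _)
      e3.symm measurableSet_Ioi
  have i2 : IntegrableOn f (Set.Ioc 0 x) := by
    have hc : Continuous f := by simp only [hf]; fun_prop
    exact (hc.integrableOn_Icc).mono_set Set.Ioc_subset_Icc_self
  have hun : Set.Ioc 0 x ∪ Set.Ioi x = Set.Ioi (0:ℝ) := Set.Ioc_union_Ioi_eq_Ioi hx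
  have i23 : IntegrableOn f (Set.Ioi 0) := by rw [← hun]; exact i2.union i3
  rw [← intervalIntegral.integral_Iic_add_Ioi i1 i23, ← hun,
    setIntegral_union (Set.Ioc_disjoint_Ioi le_rfl) measurableSet_Ioi i2 i3,
    setIntegral_congr_fun measurableSet_Iic e1, setIntegral_congr_fun measurableSet_Ioc e2,
    setIntegral_congr_fun measurableSet_Ioi e3, ← intervalIntegral.integral_of_le hx,
    integral_const_mul, integral_const_mul, integral_exp_mul_Iic hpq,
    integral_exp_mul_Ioi (by linarith : -(p + q) < 0)]
  have h3 : Real.exp (-(q * x)) = Real.exp (p * x) * Real.exp (-(p + q) * x) := by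
    rw [← Real.exp_add]; congr 1; ring
  rw [h3]
  simp only [mul_zero, Real.exp_zero]
  field_simp
  ring

lemma aux_conv_ne (p q x : ℝ) (hp : 0 < p) (hq : 0 < q) (hx : 0 ≤ x) (hne : p ≠ q) :
    ∫ y : ℝ, Real.exp (-(p * |x - y|)) * Real.exp (-(q * |y|)) =
      2 * (p * Real.exp (-(q * x)) - q * Real.exp (-(p * x))) / (p ^ 2 - q ^ 2) := by
  have hs : p - q ≠ 0 := sub_ne_zero.2 hne
  have hpq : p + q ≠ 0 := by positivity
  have h2 : p ^ 2 - q ^ 2 = (p - q) * (p + q) := by ring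
  rw [aux_conv p q x hp hq hx, intervalIntegral.integral_const_mul]
  have hJ : ∫ y in (0:ℝ)..x, Real.exp ((p - q) * y) = (Real.exp ((p - q) * x) - 1) / (p - q) := by
    rw [intervalIntegral.integral_comp_mul_left (fun y => Real.exp y) hs, integral_exp]
    simp only [mul_zero, Real.exp_zero, smul_eq_mul]
    field_simp
  have h3 : Real.exp (-(q * x)) = Real.exp (-(p * x)) * Real.exp ((p - q) * x) := by
    rw [← Real.exp_add]; congr 1; ring
  rw [hJ, h3, h2]
  field_simp
  ring

lemma aux_conv_eq (p x : ℝ) (hp : 0 < p) (hx : 0 ≤ x) :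
    ∫ y : ℝ, Real.exp (-(p * |x - y|)) * Real.exp (-(p * |y|)) =
      (1 / p + x) * Real.exp (-(p * x)) := by
  rw [aux_conv p p x hp hp hx]
  simp only [sub_self, zero_mul, Real.exp_zero, mul_one, intervalIntegral.integral_const,
    sub_zero, smul_eq_mul]
  field_simp
  ring

lemma aux_core (a b c x : ℝ) (hb : 0 < b) (hab : b < a) (hac : a < c) (hc : c ≤ a + b) :
    a * Real.exp (-(x / a)) - b * Real.exp (-(x / b)) ≤
      2 * (a ^ 2 - b ^ 2) / (2 * c - a - b) * Real.exp (-((a + b) / (2 * c)))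
        * Real.exp (-(x / c)) := by
  have ha : 0 < a := hb.trans hab
  have hc0 : 0 < c := ha.trans hac
  have d1 : 0 < c - a := by linarith
  have d2 : 0 < c - b := by linarith
  have d3 : 0 < 2 * c - a - b := by linarith
  have d4 : 0 < a - b := by linarith
  have d5 : 0 < a + b := by linarith
  obtain ⟨θ, hθ⟩ : ∃ θ, θ = (a - b) / (2 * c - a - b) := ⟨_, rfl⟩
  obtain ⟨τ, hτ⟩ : ∃ τ, τ = b * (c - a) / (a * (c - b)) := ⟨_, rfl⟩
  have hτ1 : 1 - τ = c * (a - b) / (a * (c - b)) := by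
    rw [hτ]; field_simp; ring
  have hτ0 : 0 < τ := by rw [hτ]; positivity
  have hτ10 : 0 < 1 - τ := by rw [hτ1]; positivity
  have hθ0 : 0 < θ := by rw [hθ]; positivity
  have hθ1 : θ ≤ 1 := by rw [hθ, div_le_one d3]; linarith
  obtain ⟨L1, hL1⟩ : ∃ L, L = Real.log ((c - b) / (c - a)) := ⟨_, rfl⟩
  obtain ⟨L2, hL2⟩ : ∃ L, L = Real.log (2 * (a + b) * (c - b) / (c * (2 * c - a - b))) := ⟨_, rfl⟩
  have b1 : 2 * θ ≤ L1 := by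
    have := Real.le_log_one_add_of_nonneg (x := (a - b) / (c - a)) (by positivity)
    have e : 1 + (a - b) / (c - a) = (c - b) / (c - a) := by field_simp; ring
    rw [e, ← hL1] at this
    refine le_trans (le_of_eq ?_) this
    have : (a - b) / (c - a) + 2 = (2 * c - a - b) / (c - a) := by field_simp; ring
    rw [this, hθ]
    field_simp
  have b2 : θ - θ ^ 2 * (1 - (a + b) / (2 * c)) ≤ L2 := by
    have e : 2 * (a + b) * (c - b) / (c * (2 * c - a - b)) = ((a + b) / c) * (1 + θ) := by
      rw [hθ]; field_simp; ring
    rw [hL2, e, Real.log_mul (by positivity) (by positivity)]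
    have l1 := Real.one_sub_inv_le_log_of_pos (x := (a + b) / c) (by positivity)
    have l2 := Real.le_log_one_add_of_nonneg (x := θ) hθ0.le
    have l3 : θ - θ ^ 2 / 2 ≤ 2 * θ / (θ + 2) := by
      rw [le_div_iff₀ (by positivity)]
      nlinarith [pow_pos hθ0 3]
    have l4 : θ ^ 2 * ((a + b - c) / (2 * c)) ≤ 1 - ((a + b) / c)⁻¹ := by
      have e1 : 1 - ((a + b) / c)⁻¹ = (a + b - c) / (a + b) := by field_simp
      rw [e1]
      have n0 : 0 ≤ a + b - c := by linarith
      have : (a + b - c) / (2 * c) ≤ (a + b - c) / (a + b) := by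
        apply div_le_div_of_nonneg_left n0 d5; linarith
      have n1 : 0 ≤ (a + b - c) / (2 * c) := by positivity
      have n2 : θ ^ 2 ≤ 1 := by nlinarith
      nlinarith
    have l5 : (a + b - c) / (2 * c) = (a + b) / (2 * c) - 1 / 2 := by field_simp
    rw [l5] at l4
    nlinarith
  have hid : τ * (2 * θ) + (1 - τ) * (θ - θ ^ 2 * (1 - (a + b) / (2 * c)) - (a + b) / (2 * c)) = 0 := by
    have hD : θ * (2 * c - a - b) - (a - b) = 0 := by rw [hθ, div_mul_cancel₀ _ d3.ne', sub_self]
    have w : θ ^ 2 * (1 - (a + b) / (2 * c)) = θ * (a - b) / (2 * c) := by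
      have w1 : θ ^ 2 * (1 - (a + b) / (2 * c)) = θ * (θ * (2 * c - a - b)) / (2 * c) := by
        field_simp; ring
      rw [w1, sub_eq_zero.1 hD]
    have e : τ * (2 * θ) + (1 - τ) * (θ - θ * (a - b) / (2 * c) - (a + b) / (2 * c)) =
        (a + b) / (2 * a * (c - b)) * (θ * (2 * c - a - b) - (a - b)) := by
      rw [hτ1, hτ]; field_simp; ring
    rw [w, e, hD, mul_zero]
  have hkey : 0 ≤ τ * L1 + (1 - τ) * (L2 - (a + b) / (2 * c)) := by
    nlinarith [mul_le_mul_of_nonneg_left b1 hτ0.le, mul_le_mul_of_nonneg_left b2 hτ10.le]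
  have hx : τ * (x / b) + (1 - τ) * (x / c) = x / a := by
    rw [hτ1, hτ]; field_simp; ring
  have hconv := convexOn_exp.2 (Set.mem_univ (L1 - x / b))
    (Set.mem_univ (L2 - (a + b) / (2 * c) - x / c)) hτ0.le hτ10.le (by ring)
  simp only [smul_eq_mul] at hconv
  have hle : Real.exp (-(x / a)) ≤ Real.exp (τ * (L1 - x / b) + (1 - τ) * (L2 - (a + b) / (2 * c) - x / c)) := by
    apply Real.exp_le_exp.2
    nlinarith
  have h1 : Real.exp (L1 - x / b) = (c - b) / (c - a) * Real.exp (-(x / b)) := by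
    rw [sub_eq_add_neg, Real.exp_add, hL1, Real.exp_log (by positivity)]
  have h2 : Real.exp (L2 - (a + b) / (2 * c) - x / c) =
      2 * (a + b) * (c - b) / (c * (2 * c - a - b)) * Real.exp (-((a + b) / (2 * c)))
        * Real.exp (-(x / c)) := by
    rw [sub_eq_add_neg, sub_eq_add_neg, Real.exp_add, Real.exp_add, hL2,
      Real.exp_log (by positivity)]
  have hfin := mul_le_mul_of_nonneg_left (hle.trans hconv) ha.le
  rw [h1, h2, hτ1, hτ] at hfin
  have f1 : a * (b * (c - a) / (a * (c - b)) * ((c - b) / (c - a) * Real.exp (-(x / b)))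
      + c * (a - b) / (a * (c - b)) * (2 * (a + b) * (c - b) / (c * (2 * c - a - b))
        * Real.exp (-((a + b) / (2 * c))) * Real.exp (-(x / c)))) =
      b * Real.exp (-(x / b)) + 2 * (a ^ 2 - b ^ 2) / (2 * c - a - b)
        * Real.exp (-((a + b) / (2 * c))) * Real.exp (-(x / c)) := by
    field_simp
    ring
  rw [f1] at hfin
  linarith

lemma aux_core_eq (a c x : ℝ) (ha : 0 < a) (hac : a < c) (hc : c ≤ 2 * a) (hx : 0 ≤ x) :
    (1 + x / a) * Real.exp (-(x / a)) ≤
      2 * a / (c - a) * Real.exp (-(a / c)) * Real.exp (-(x / c)) := by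
  have hc0 : 0 < c := ha.trans hac
  have d : 0 < c - a := by linarith
  have h := Real.add_one_le_exp (x / a - x / c - a / c)
  have e : x / a - x / c - a / c + 1 = (c - a) / c * (1 + x / a) := by field_simp; ring
  rw [e] at h
  have h2 : 1 + x / a ≤ 2 * a / (c - a) * Real.exp (x / a - x / c - a / c) := by
    refine le_trans ?_ (mul_le_mul_of_nonneg_left h (by positivity))
    have e2 : 2 * a / (c - a) * ((c - a) / c * (1 + x / a)) = 2 * a / c * (1 + x / a) := by
      field_simp
    rw [e2]
    have : 1 ≤ 2 * a / c := by rw [le_div_iff₀ hc0]; linarith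
    exact le_mul_of_one_le_left (by positivity) this
  have h3 := mul_le_mul_of_nonneg_right h2 (Real.exp_pos (-(x / a))).le
  refine h3.trans (le_of_eq ?_)
  rw [mul_assoc, mul_assoc, ← Real.exp_add, ← Real.exp_add]
  congr 2; ring

/-- The bound for the convolution, with the constant expressed through `k = 2c/(a+b)`. -/
lemma aux_bound (a b c x : ℝ) (ha : 0 < a) (hb : 0 < b) (hac : a < c) (hbc : b < c)
    (hc : c ≤ a + b) (hx : 0 ≤ x) :
    ∫ y : ℝ, Real.exp (-(1 / a * |x - y|)) * Real.exp (-(1 / b * |y|)) ≤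
      4 * a * b / (2 * c - a - b) * Real.exp (-((a + b) / (2 * c))) * Real.exp (-(x / c)) := by
  have hc0 : 0 < c := ha.trans hac
  have d3 : 0 < 2 * c - a - b := by linarith
  have ea : ∀ z : ℝ, 1 / z * x = x / z := fun z => by ring
  rcases lt_trichotomy a b with h | h | h
  · have hne : 1 / a ≠ 1 / b := by
      intro h'; rw [one_div, one_div, inv_inj] at h'; exact h.ne h'
    rw [aux_conv_ne _ _ x (by positivity) (by positivity) hx hne, ea, ea]
    have h1 := aux_core b a c x ha h hbc (by linarith)
    have d : 0 < b ^ 2 - a ^ 2 := by nlinarith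
    have e : 2 * (1 / a * Real.exp (-(x / b)) - 1 / b * Real.exp (-(x / a))) / ((1 / a) ^ 2 - (1 / b) ^ 2)
        = 2 * a * b / (b ^ 2 - a ^ 2) * (b * Real.exp (-(x / b)) - a * Real.exp (-(x / a))) := by
      have : (1 / a) ^ 2 - (1 / b) ^ 2 = (b ^ 2 - a ^ 2) / (a ^ 2 * b ^ 2) := by field_simp
      rw [this]; field_simp
    rw [e]
    refine (mul_le_mul_of_nonneg_left h1 (by positivity)).trans (le_of_eq ?_)
    rw [show 2 * c - b - a = 2 * c - a - b by ring, add_comm b a]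
    field_simp
    ring
  · subst h
    rw [aux_conv_eq _ x (by positivity) hx, ea, one_div_one_div]
    have h1 := aux_core_eq a c x ha hac (by linarith) hx
    have e : (a + x) * Real.exp (-(x / a)) = a * ((1 + x / a) * Real.exp (-(x / a))) := by
      field_simp
    rw [e]
    refine (mul_le_mul_of_nonneg_left h1 ha.le).trans (le_of_eq ?_)
    have d : 0 < c - a := by linarith
    rw [show 2 * c - a - a = 2 * (c - a) by ring, show (a + a) / (2 * c) = a / c by field_simp; ring]
    field_simp
    ring
  · have hne : 1 / a ≠ 1 / b := by
      intro h'; rw [one_div, one_div, inv_inj] at h'; exact h.ne' h'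
    rw [aux_conv_ne _ _ x (by positivity) (by positivity) hx hne, ea, ea]
    have h1 := aux_core a b c x hb h hac (by linarith)
    have d : 0 < a ^ 2 - b ^ 2 := by nlinarith
    have e : 2 * (1 / a * Real.exp (-(x / b)) - 1 / b * Real.exp (-(x / a))) / ((1 / a) ^ 2 - (1 / b) ^ 2)
        = 2 * a * b / (a ^ 2 - b ^ 2) * (a * Real.exp (-(x / a)) - b * Real.exp (-(x / b))) := by
      have : (1 / a) ^ 2 - (1 / b) ^ 2 = -(a ^ 2 - b ^ 2) / (a ^ 2 * b ^ 2) := by field_simp; ring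
      rw [this]; field_simp; ring
    rw [e]
    refine (mul_le_mul_of_nonneg_left h1 (by positivity)).trans (le_of_eq ?_)
    field_simp
    ring

lemma aux_mono (u v : ℝ) (hu : 0 < u) (huv : u ≤ v) (hv : v < 1) :
    1 / (1 - u) * Real.exp (-u) ≤ 1 / (1 - v) * Real.exp (-v) := by
  have d1 : 0 < 1 - u := by linarith
  have d2 : 0 < 1 - v := by linarith
  have h := Real.add_one_le_exp (u - v)
  have h2 : (1 - v) / (1 - u) ≤ Real.exp (u - v) := by
    refine le_trans ?_ h
    rw [div_le_iff₀ d1]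
    nlinarith
  have h3 := mul_le_mul_of_nonneg_right h2 (Real.exp_pos (-u)).le
  rw [← Real.exp_add, show u - v + -u = -v by ring] at h3
  have h4 := mul_le_mul_of_nonneg_left h3 (by positivity : 0 ≤ 1 / (1 - v))
  refine le_trans (le_of_eq ?_) h4
  field_simp

lemma aux_even (β t s x : ℝ) :
    (∫ y : ℝ, expKernel β t (x - y) * expKernel β s y) =
      ∫ y : ℝ, expKernel β t (|x| - y) * expKernel β s y := by
  rcases abs_cases x with ⟨h, -⟩ | ⟨h, -⟩
  · rw [h]
  · rw [h, ← integral_neg_eq_self]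
    congr 1; ext y
    simp only [expKernel, abs_neg]
    rw [← abs_neg (x - -y), show -(x - -y) = -x - y by ring]

/-- for `β ∈ (0,2]`, `t, s > 0` and `x ∈ ℝ`,
`∫_ℝ 𝒢_{e,β}(t, x−y) 𝒢_{e,β}(s, y) dy ≤ Ĉ_β · 𝒢_{e,β}(t+s, x)`, where
`Ĉ_β = (2^{β/2}/(2^{β/2}−1)) · exp(−2^{−β/2})`. -/
theorem expKernel_subSemigroup (β : ℝ) (hβ : β ∈ Set.Ioc (0 : ℝ) 2)
    (t s : ℝ) (ht : 0 < t) (hs : 0 < s) (x : ℝ) :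
    (∫ y : ℝ, expKernel β t (x - y) * expKernel β s y)
      ≤ (2 : ℝ) ^ (β / 2) / ((2 : ℝ) ^ (β / 2) - 1) * Real.exp (-(2 : ℝ) ^ (-(β / 2)))
          * expKernel β (t + s) x := by
  have hγ0 : 0 < β / 2 := by linarith [hβ.1]
  have hγ1 : β / 2 ≤ 1 := by linarith [hβ.2]
  rw [aux_even]
  have habs : expKernel β (t + s) x = expKernel β (t + s) |x| := by simp [expKernel]
  rw [habs]
  have hx : 0 ≤ |x| := abs_nonneg x
  generalize |x| = z at hx
  unfold expKernel
  generalize β / 2 = γ at hγ0 hγ1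
  have ha : 0 < t ^ γ := Real.rpow_pos_of_pos ht _
  have hb : 0 < s ^ γ := Real.rpow_pos_of_pos hs _
  have hac : t ^ γ < (t + s) ^ γ := Real.rpow_lt_rpow ht.le (by linarith) hγ0
  have hbc : s ^ γ < (t + s) ^ γ := Real.rpow_lt_rpow hs.le (by linarith) hγ0
  have hc : (t + s) ^ γ ≤ t ^ γ + s ^ γ := Real.rpow_add_le_add_rpow ht.le hs.le hγ0.le hγ1
  have hk1 : 1 < (2 : ℝ) ^ γ := Real.one_lt_rpow (by norm_num) hγ0
  have hk : (2 : ℝ) ^ γ * (t ^ γ + s ^ γ) ≤ 2 * (t + s) ^ γ := by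
    have h := (Real.concaveOn_rpow hγ0.le hγ1).2 (Set.mem_Ici.2 ht.le) (Set.mem_Ici.2 hs.le)
      (by norm_num : (0 : ℝ) ≤ 1 / 2) (by norm_num : (0 : ℝ) ≤ 1 / 2) (by norm_num)
    simp only [smul_eq_mul] at h
    have e : (t + s) ^ γ = (2 : ℝ) ^ γ * (1 / 2 * t + 1 / 2 * s) ^ γ := by
      rw [← Real.mul_rpow (by norm_num) (by positivity)]; congr 1; ring
    rw [e]
    nlinarith
  rw [Real.rpow_neg (by norm_num : (0 : ℝ) ≤ 2)]
  generalize (2 : ℝ) ^ γ = k at hk1 hk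
  generalize t ^ γ = a at *
  generalize s ^ γ = b at *
  generalize (t + s) ^ γ = c at *
  have hc0 : 0 < c := ha.trans hac
  have hk0 : 0 < k := by linarith
  have d3 : 0 < 2 * c - a - b := by linarith
  have dk : 0 < k - 1 := by linarith
  have hI : (∫ y : ℝ, 1 / (2 * a) * Real.exp (-|z - y| / a) * (1 / (2 * b) * Real.exp (-|y| / b)))
      = 1 / (4 * a * b) *
        ∫ y : ℝ, Real.exp (-(1 / a * |z - y|)) * Real.exp (-(1 / b * |y|)) := by
    rw [← integral_const_mul]
    congr 1; ext y
    rw [show -|z - y| / a = -(1 / a * |z - y|) by ring, show -|y| / b = -(1 / b * |y|) by ring]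
    field_simp
    ring
  rw [hI, abs_of_nonneg hx]
  refine (mul_le_mul_of_nonneg_left (aux_bound a b c z ha hb hac hbc hc hx) (by positivity)).trans ?_
  have hm := aux_mono ((a + b) / (2 * c)) k⁻¹ (by positivity)
    (by rw [inv_eq_one_div, div_le_div_iff₀ (by positivity) hk0]; linarith)
    (inv_lt_one_of_one_lt₀ hk1)
  have e1 : 1 / (1 - (a + b) / (2 * c)) = 2 * c / (2 * c - a - b) := by
    have : 1 - (a + b) / (2 * c) = (2 * c - a - b) / (2 * c) := by field_simp; ring
    rw [this, one_div_div]
  have e2 : 1 / (1 - k⁻¹) = k / (k - 1) := by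
    have : 1 - k⁻¹ = (k - 1) / k := by field_simp
    rw [this, one_div_div]
  rw [e1, e2] at hm
  have h := mul_le_mul_of_nonneg_right hm
    (by positivity : 0 ≤ 1 / (2 * c) * Real.exp (-z / c))
  refine le_trans (le_of_eq ?_) h
  rw [neg_div]
  field_simp
end

section
/- Let β ∈ (0,2] and let G : (0,∞) × ℝ → ℝ satisfy the scaling property G(t,x) = t^{−β/2} · G(1, x / t^{β/2}) for all t > 0 and x ∈ ℝ, and suppose C₀ := sup_{x ∈ ℝ} G(1,x)² / 𝒢_{e,β}(1,x) is finite. Then: (a) G(t,x)² ≤ C₀ · t^{−β/2} · 𝒢_{e,β}(t, x) for all t > 0, x ∈ ℝ; and (b) ∫_ℝ 𝒢_{e,β}(t, x−y) · 𝒢_{e,β}(s, y) dy ≤ Ĉ_β · 𝒢_{e,β}(t+s, x) for all t, s > 0 and x ∈ ℝ, where Ĉ_β = (2^{β/2} / (2^{β/2} − 1)) · exp(−2^{−β/2}). -/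
open MeasureTheory

lemma ek_log_lb {p q : ℝ} (hp : 0 < p) (hpq : p ≤ q) :
    2 * (q - p) / (q + p) ≤ Real.log q - Real.log p := by
  have hq : 0 < q := hp.trans_le hpq
  have h := Real.le_log_one_add_of_nonneg (x := (q - p) / p) (div_nonneg (by linarith) hp.le)
  have e1 : 1 + (q - p) / p = q / p := by field_simp; ring
  rw [e1, Real.log_div hq.ne' hp.ne'] at h
  have e2 : 2 * ((q - p) / p) / ((q - p) / p + 2) = 2 * (q - p) / (q + p) := by
    have : (q - p) / p + 2 = (q + p) / p := by field_simp; ring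
    rw [this]; field_simp
  rwa [e2] at h

lemma ek_const {p q d : ℝ} (hp : 0 < p) (hpq : p ≤ q) (h1 : p + q ≤ 1) (hd : 0 < d)
    (hdm : 2 * d ≤ p + q) :
    -(2 * p * (1 - q) / (p + q)) - Real.log q - Real.log (2 - p - q)
      ≤ -(1 - d) - Real.log d := by
  have hq : 0 < q := hp.trans_le hpq
  have hm : 0 < (p + q) / 2 := by linarith
  have A := Real.log_le_sub_one_of_pos (x := d / ((p + q) / 2)) (by positivity)
  rw [Real.log_div hd.ne' hm.ne'] at A
  have A' : d / ((p + q) / 2) - 1 ≤ d - (p + q) / 2 := by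
    rw [sub_le_iff_le_add, div_le_iff₀ hm]; nlinarith
  have B := ek_log_lb hm (by linarith : (p + q) / 2 ≤ q)
  have B' : 2 * (q - (p + q) / 2) / (q + (p + q) / 2) = 2 * (q - p) / (3 * q + p) := by
    rw [div_eq_div_iff (by positivity) (by positivity)]; ring
  rw [B'] at B
  have C := Real.one_sub_inv_le_log_of_pos (x := 2 - p - q) (by linarith)
  have C' : (1 - p - q) / 2 ≤ 1 - (2 - p - q)⁻¹ := by
    have h2 : 0 < 2 - p - q := by linarith
    have e : 1 - (2 - p - q)⁻¹ = (1 - p - q) / (2 - p - q) := by field_simp; ring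
    rw [e]
    exact div_le_div_of_nonneg_left (by linarith) h2 (by linarith)
  have D : 1 / 2 ≤ 2 * p * (1 - q) / (p + q) + 2 * (q - p) / (3 * q + p) := by
    rw [div_add_div _ _ (by positivity) (by positivity), div_le_div_iff₀ (by norm_num) (by positivity)]
    have h3 : 0 ≤ (q - p) ^ 3 := pow_nonneg (by linarith) 3
    have h4 : 0 ≤ (q ^ 2 + 8 * p * q - p ^ 2) * (1 - (p + q)) :=
      mul_nonneg (by nlinarith [mul_pos hp hq]) (by linarith)
    nlinarith
  linarith

lemma ek_ne {a b d x : ℝ} (hb : 0 < b) (hab : b < a) (ha : a < 1) (h1 : 1 ≤ a + b) (hd : 0 < d)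
    (hdm : a + b ≤ 2 * (1 - d)) (hx : 0 ≤ x) :
    (a * Real.exp (-x / a) - b * Real.exp (-x / b)) / (a ^ 2 - b ^ 2)
      ≤ Real.exp (-(1 - d)) / d * Real.exp (-x) := by
  have ha0 : 0 < a := hb.trans hab
  have hs : 0 < a - b := by linarith
  have hp : 0 < 1 - a := by linarith
  have hq : 0 < 1 - b := by linarith
  set δ := 1 / b - 1 / a with hδ
  have hδ0 : δ = (a - b) / (a * b) := by rw [hδ]; field_simp
  have hδp : 0 < δ := by rw [hδ0]; positivity
  set u := Real.exp (-x * δ) with hu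
  have hu0 : 0 < u := Real.exp_pos _
  have hu1 : u ≤ 1 := by
    rw [hu]; apply Real.exp_le_one_iff.2; nlinarith
  have hw : 0 < a - b * u := by nlinarith
  have E1 : Real.exp (-x / b) = Real.exp (-x / a) * u := by
    rw [hu, ← Real.exp_add, hδ]; congr 1; field_simp; ring
  have hsq : 0 < a ^ 2 - b ^ 2 := by nlinarith
  rw [E1, div_le_iff₀ hsq]
  have e0 : a * Real.exp (-x / a) - b * (Real.exp (-x / a) * u)
      = Real.exp (-x / a) * (a - b * u) := by ring
  rw [e0]
  have hL : 0 < Real.exp (-x / a) * (a - b * u) := by positivity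
  have hR : 0 < Real.exp (-(1 - d)) / d * Real.exp (-x) * (a ^ 2 - b ^ 2) := by positivity
  rw [← Real.log_le_log_iff hL hR, Real.log_mul (Real.exp_pos _).ne' hw.ne', Real.log_exp,
    Real.log_mul (by positivity) hsq.ne', Real.log_mul (by positivity) (by positivity),
    Real.log_div (by positivity) hd.ne', Real.log_exp, Real.log_exp]
  have es : a ^ 2 - b ^ 2 = (a - b) * (a + b) := by ring
  rw [es, Real.log_mul hs.ne' (by positivity)]
  have K := ek_const hp (by linarith : 1 - a ≤ 1 - b) (by linarith) hd (by linarith)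
  have e2 : 2 - (1 - a) - (1 - b) = a + b := by ring
  rw [e2] at K
  -- tangent bounds
  have T1 := Real.log_le_sub_one_of_pos (x := (a - b * u) / ((a - b) / (1 - b))) (by positivity)
  rw [Real.log_div hw.ne' (by positivity), Real.log_div hs.ne' hq.ne'] at T1
  have T2 := Real.log_le_sub_one_of_pos (x := u / ((1 - a) / (1 - b))) (by positivity)
  rw [Real.log_div hu0.ne' (by positivity), Real.log_div hp.ne' hq.ne', hu, Real.log_exp,
    ← hu] at T2
  have T3 := ek_log_lb hp (by linarith : 1 - a ≤ 1 - b)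
  have hκ : 0 ≤ (1 - a) * b / (a - b) := by positivity
  have T2' := mul_le_mul_of_nonneg_left T2 hκ
  have T3' := mul_le_mul_of_nonneg_left T3 hκ
  have f1 : (1 - a) * b / (a - b) * (2 * (1 - b - (1 - a)) / (1 - b + (1 - a)))
      = 2 * (1 - a) * (1 - (1 - b)) / (1 - a + (1 - b)) := by
    have : 1 - b + (1 - a) ≠ 0 := by positivity
    have h' : 1 - a + (1 - b) ≠ 0 := by positivity
    field_simp
    ring
  have f2 : (1 - a) * b / (a - b) * (u / ((1 - a) / (1 - b)) - 1)
      + ((a - b * u) / ((a - b) / (1 - b)) - 1) = 0 := by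
    field_simp; ring
  have f3 : (1 - a) * b / (a - b) * (-x * δ) = -x / a + x := by
    rw [hδ0]; field_simp; ring
  rw [f1] at T3'
  rw [mul_sub, f3] at T2'
  nlinarith

lemma ek_eq {a d x : ℝ} (ha0 : 0 < a) (ha : a < 1) (h1 : 1 ≤ 2 * a) (hd : 0 < d)
    (hdm : a ≤ 1 - d) (hx : 0 ≤ x) :
    (1 + x / a) * Real.exp (-x / a) / (2 * a)
      ≤ Real.exp (-(1 - d)) / d * Real.exp (-x) := by
  have hp : 0 < 1 - a := by linarith
  have hz : 0 < 1 + x / a := by positivity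
  rw [div_le_iff₀ (by positivity)]
  rw [← Real.log_le_log_iff (by positivity) (by positivity), Real.log_mul hz.ne' (by positivity),
    Real.log_exp, Real.log_mul (by positivity) (by positivity),
    Real.log_mul (by positivity) (by positivity),
    Real.log_div (by positivity) hd.ne', Real.log_exp, Real.log_exp]
  have K := ek_const hp (le_refl (1 - a)) (by linarith) hd (by linarith)
  have e2 : 2 - (1 - a) - (1 - a) = 2 * a := by ring
  have e3 : 2 * (1 - a) * (1 - (1 - a)) / (1 - a + (1 - a)) = a := by
    have : 1 - a + (1 - a) ≠ 0 := by positivity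
    field_simp; ring
  rw [e2, e3] at K
  have T := Real.log_le_sub_one_of_pos (x := (1 - a) * (1 + x / a)) (by positivity)
  rw [Real.log_mul hp.ne' hz.ne'] at T
  have e4 : (1 - a) * (1 + x / a) - 1 = x / a - x - a := by field_simp; ring
  rw [e4] at T
  rw [neg_div]
  linarith

lemma ek_int {a b x : ℝ} (ha : 0 < a) (hb : 0 < b) (hx : 0 ≤ x) :
    ∫ y : ℝ, Real.exp (-|x - y| / a) * Real.exp (-|y| / b)
      = Real.exp (-x / a) * (a * b / (a + b)) + Real.exp (-x / b) * (a * b / (a + b))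
        + Real.exp (-x / a) * ∫ y in (0 : ℝ)..x, Real.exp ((1 / a - 1 / b) * y) := by
  have hk : 0 < 1 / a + 1 / b := by positivity
  have hkn : -(1 / a + 1 / b) < 0 := by linarith
  set f : ℝ → ℝ := fun y => Real.exp (-|x - y| / a) * Real.exp (-|y| / b) with hf
  have c1 : Set.EqOn f (fun y => Real.exp (-x / a) * Real.exp ((1 / a + 1 / b) * y))
      (Set.Iic 0) := by
    intro y hy
    have hy : y ≤ 0 := hy
    simp only [hf]
    rw [abs_of_nonneg (by linarith), abs_of_nonpos hy, ← Real.exp_add, ← Real.exp_add]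
    congr 1; field_simp; ring
  have c2 : Set.EqOn f (fun y => Real.exp (-x / a) * Real.exp ((1 / a - 1 / b) * y))
      (Set.Ioc 0 x) := by
    intro y hy
    simp only [hf]
    rw [abs_of_nonneg (by linarith [hy.2]), abs_of_nonneg hy.1.le, ← Real.exp_add, ← Real.exp_add]
    congr 1; field_simp; ring
  have c3 : Set.EqOn f (fun y => Real.exp (x / a) * Real.exp (-(1 / a + 1 / b) * y))
      (Set.Ioi x) := by
    intro y hy
    have hy : x < y := hy
    simp only [hf]
    rw [abs_of_nonpos (by linarith), abs_of_nonneg (by linarith), ← Real.exp_add, ← Real.exp_add]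
    congr 1; field_simp; ring
  have i1 : IntegrableOn f (Set.Iic 0) :=
    IntegrableOn.congr_fun (Integrable.const_mul (integrableOn_exp_mul_Iic hk 0) _) c1.symm
      measurableSet_Iic
  have i3 : IntegrableOn f (Set.Ioi x) :=
    IntegrableOn.congr_fun (Integrable.const_mul (integrableOn_exp_mul_Ioi hkn x) _) c3.symm
      measurableSet_Ioi
  have fc : Continuous f := by
    simp only [hf]; fun_prop
  have i2 : IntegrableOn f (Set.Ioc 0 x) := fc.integrableOn_Ioc
  have i23 : IntegrableOn f (Set.Ioi 0) := by
    rw [← Set.Ioc_union_Ioi_eq_Ioi hx]; exact i2.union i3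
  have s1 : ∫ y, f y = (∫ y in Set.Iic 0, f y) + ∫ y in Set.Ioi 0, f y := by
    have := intervalIntegral.integral_Iic_add_Ioi i1 i23
    exact this.symm
  have s2 : ∫ y in Set.Ioi 0, f y = (∫ y in Set.Ioc 0 x, f y) + ∫ y in Set.Ioi x, f y := by
    rw [← Set.Ioc_union_Ioi_eq_Ioi hx]
    exact setIntegral_union (Set.Ioc_disjoint_Ioi le_rfl) measurableSet_Ioi i2 i3
  rw [s1, s2, setIntegral_congr_fun measurableSet_Iic c1,
    setIntegral_congr_fun measurableSet_Ioc c2, setIntegral_congr_fun measurableSet_Ioi c3,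
    integral_const_mul, integral_const_mul, integral_const_mul, integral_exp_mul_Iic hk,
    integral_exp_mul_Ioi hkn, intervalIntegral.integral_of_le hx]
  have e3 : Real.exp (x / a) * (-Real.exp (-(1 / a + 1 / b) * x) / -(1 / a + 1 / b))
      = Real.exp (-x / b) * (a * b / (a + b)) := by
    have : Real.exp (-x / b) = Real.exp (x / a) * Real.exp (-(1 / a + 1 / b) * x) := by
      rw [← Real.exp_add]; congr 1; field_simp; ring
    rw [this, neg_div_neg_eq]
    have : 1 / a + 1 / b = (a + b) / (a * b) := by field_simp; ring
    generalize Real.exp (-(1 / a + 1 / b) * x) = E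
    rw [this]; field_simp
  have e1 : Real.exp ((1 / a + 1 / b) * 0) / (1 / a + 1 / b) = a * b / (a + b) := by
    rw [mul_zero, Real.exp_zero]; field_simp; ring
  rw [e3, e1]
  ring

lemma ek_int_ne {a b x : ℝ} (ha : 0 < a) (hb : 0 < b) (hab : a ≠ b) (hx : 0 ≤ x) :
    ∫ y : ℝ, Real.exp (-|x - y| / a) * Real.exp (-|y| / b)
      = 2 * a * b * ((a * Real.exp (-x / a) - b * Real.exp (-x / b)) / (a ^ 2 - b ^ 2)) := by
  have hs : a - b ≠ 0 := sub_ne_zero.2 hab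
  have hba : b - a ≠ 0 := sub_ne_zero.2 hab.symm
  have hc : 1 / a - 1 / b ≠ 0 := by
    have : 1 / a - 1 / b = (b - a) / (a * b) := by field_simp
    rw [this]; positivity
  rw [ek_int ha hb hx, intervalIntegral.integral_comp_mul_left (fun y => Real.exp y) hc,
    integral_exp, mul_zero, Real.exp_zero, smul_eq_mul]
  have E : Real.exp (-x / b) = Real.exp (-x / a) * Real.exp ((1 / a - 1 / b) * x) := by
    rw [← Real.exp_add]; congr 1; field_simp; ring
  rw [E]
  generalize Real.exp ((1 / a - 1 / b) * x) = F
  have : (1 / a - 1 / b)⁻¹ = -(a * b) / (a - b) := by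
    rw [inv_eq_iff_eq_inv, inv_div]; field_simp; ring
  rw [this]
  have es : a ^ 2 - b ^ 2 = (a - b) * (a + b) := by ring
  rw [es]
  have : a + b ≠ 0 := by positivity
  field_simp
  ring

lemma ek_int_eq {a x : ℝ} (ha : 0 < a) (hx : 0 ≤ x) :
    ∫ y : ℝ, Real.exp (-|x - y| / a) * Real.exp (-|y| / a)
      = 2 * a * a * ((1 + x / a) * Real.exp (-x / a) / (2 * a)) := by
  rw [ek_int ha ha hx]
  simp
  field_simp

lemma ek_main {a b c d x : ℝ} (ha : 0 < a) (hb : 0 < b) (hac : a < c) (hbc : b < c)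
    (h1 : c ≤ a + b) (hd : 0 < d) (hdm : a + b ≤ 2 * (1 - d) * c) (hx : 0 ≤ x) :
    ∫ y : ℝ, Real.exp (-|x - y| / a) * Real.exp (-|y| / b)
      ≤ 2 * a * b * (Real.exp (-(1 - d)) / d * Real.exp (-x / c) / c) := by
  have hc : 0 < c := ha.trans hac
  have key : ∀ a b : ℝ, 0 < b → b < a → a < c → c ≤ a + b → a + b ≤ 2 * (1 - d) * c →
      (a * Real.exp (-x / a) - b * Real.exp (-x / b)) / (a ^ 2 - b ^ 2)
        ≤ Real.exp (-(1 - d)) / d * Real.exp (-x / c) / c := by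
    intro a b hb hab hac h1 h2
    have ha : 0 < a := hb.trans hab
    have h := ek_ne (a := a / c) (b := b / c) (d := d) (x := x / c) (by positivity)
      (by gcongr) ((div_lt_one hc).2 hac) (by rw [← add_div, le_div_iff₀ hc]; linarith) hd
      (by rw [← add_div, div_le_iff₀ hc]; linarith) (by positivity)
    have g1 : -(x / c) / (a / c) = -x / a := by field_simp
    have g2 : -(x / c) / (b / c) = -x / b := by field_simp
    rw [g1, g2, ← neg_div] at h
    rw [le_div_iff₀ hc]
    refine le_trans (le_of_eq ?_) h
    have es : a ^ 2 - b ^ 2 ≠ 0 := by nlinarith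
    have es' : (a / c) ^ 2 - (b / c) ^ 2 = (a ^ 2 - b ^ 2) / c ^ 2 := by field_simp
    rw [es']
    field_simp
  rcases lt_trichotomy a b with h | h | h
  · rw [ek_int_ne ha hb h.ne hx]
    apply mul_le_mul_of_nonneg_left _ (by positivity)
    refine le_trans (le_of_eq ?_) (key b a ha h hbc (by linarith) (by linarith))
    rw [← neg_div_neg_eq]; congr 1 <;> ring
  · subst h
    rw [ek_int_eq ha hx]
    apply mul_le_mul_of_nonneg_left _ (by positivity)
    have h := ek_eq (a := a / c) (d := d) (x := x / c) (by positivity)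
      ((div_lt_one hc).2 hac) (by rw [← mul_div_assoc, le_div_iff₀ hc]; linarith) hd
      (by rw [div_le_iff₀ hc]; linarith) (by positivity)
    have g1 : -(x / c) / (a / c) = -x / a := by field_simp
    have g2 : (x / c) / (a / c) = x / a := by field_simp
    rw [g1, g2, ← neg_div] at h
    rw [le_div_iff₀ hc]
    refine le_trans (le_of_eq ?_) h
    field_simp
  · rw [ek_int_ne ha hb h.ne' hx]
    apply mul_le_mul_of_nonneg_left _ (by positivity)
    exact key a b hb h hac h1 hdm

lemma ek_main_abs {a b c d : ℝ} (x : ℝ) (ha : 0 < a) (hb : 0 < b) (hac : a < c) (hbc : b < c)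
    (h1 : c ≤ a + b) (hd : 0 < d) (hdm : a + b ≤ 2 * (1 - d) * c) :
    ∫ y : ℝ, Real.exp (-|x - y| / a) * Real.exp (-|y| / b)
      ≤ 2 * a * b * (Real.exp (-(1 - d)) / d * Real.exp (-|x| / c) / c) := by
  rcases le_total 0 x with h | h
  · rw [abs_of_nonneg h]; exact ek_main ha hb hac hbc h1 hd hdm h
  · rw [abs_of_nonpos h]
    have := ek_main (x := -x) ha hb hac hbc h1 hd hdm (by linarith)
    rw [← integral_neg_eq_self] at this
    refine le_trans (le_of_eq ?_) this
    congr 1; ext y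
    rw [abs_neg, show -x - -y = -(x - y) by ring, abs_neg]

/-- let `β ∈ (0,2]` and suppose `G(t,x) = t^{−β/2} G(1, x/t^{β/2})` and
`C₀ = sup_x G(1,x)²/𝒢_{e,β}(1,x)` is finite. Then:
(a) `G(t,x)² ≤ C₀ t^{−β/2} 𝒢_{e,β}(t, x)`; and
(b) `∫ 𝒢_{e,β}(t, x−y) 𝒢_{e,β}(s, y) dy ≤ Ĉ_β 𝒢_{e,β}(t+s, x)` with
`Ĉ_β = (2^{β/2}/(2^{β/2}−1)) exp(−2^{−β/2})`. -/
theorem exponential_reference_kernel (β : ℝ) (hβ : β ∈ Set.Ioc (0 : ℝ) 2)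
    (G : ℝ → ℝ → ℝ)
    (hscal : ∀ t : ℝ, 0 < t → ∀ x : ℝ, G t x = t ^ (-(β / 2)) * G 1 (x / t ^ (β / 2)))
    (hbdd : BddAbove (Set.range fun x : ℝ => G 1 x ^ 2 / expKernel β 1 x))
    (C₀ : ℝ) (hC₀ : C₀ = ⨆ x : ℝ, G 1 x ^ 2 / expKernel β 1 x) :
    (∀ t : ℝ, 0 < t → ∀ x : ℝ,
      G t x ^ 2 ≤ C₀ * t ^ (-(β / 2)) * expKernel β t x) ∧
    (∀ t s : ℝ, 0 < t → 0 < s → ∀ x : ℝ,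
      (∫ y : ℝ, expKernel β t (x - y) * expKernel β s y)
        ≤ (2 : ℝ) ^ (β / 2) / ((2 : ℝ) ^ (β / 2) - 1) * Real.exp (-(2 : ℝ) ^ (-(β / 2)))
            * expKernel β (t + s) x) := by
  obtain ⟨hβ0, hβ2⟩ := hβ
  refine ⟨?_, ?_⟩
  · intro t ht x
    have hT : 0 < t ^ (β / 2) := Real.rpow_pos_of_pos ht _
    have h := le_ciSup hbdd (x / t ^ (β / 2))
    rw [← hC₀] at h
    have hpos : 0 < expKernel β 1 (x / t ^ (β / 2)) := by
      unfold expKernel; positivity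
    have h2 : G 1 (x / t ^ (β / 2)) ^ 2 ≤ C₀ * expKernel β 1 (x / t ^ (β / 2)) := by
      rwa [← div_le_iff₀ hpos]
    rw [hscal t ht x, mul_pow]
    have e : expKernel β t x = t ^ (-(β / 2)) * expKernel β 1 (x / t ^ (β / 2)) := by
      unfold expKernel
      rw [Real.rpow_neg ht.le, Real.one_rpow, abs_div, abs_of_pos hT, div_one, neg_div]
      field_simp
    rw [e]
    have hn : 0 ≤ (t ^ (-(β / 2))) ^ 2 := by positivity
    calc _ ≤ (t ^ (-(β / 2))) ^ 2 * (C₀ * expKernel β 1 (x / t ^ (β / 2))) :=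
          mul_le_mul_of_nonneg_left h2 hn
      _ = _ := by ring
  · intro t s ht hs x
    have hg0 : 0 < β / 2 := by linarith
    have hg1 : β / 2 ≤ 1 := by linarith
    have ha : 0 < t ^ (β / 2) := Real.rpow_pos_of_pos ht _
    have hb : 0 < s ^ (β / 2) := Real.rpow_pos_of_pos hs _
    have hc : 0 < (t + s) ^ (β / 2) := Real.rpow_pos_of_pos (by linarith) _
    have hk : 1 < (2 : ℝ) ^ (β / 2) := Real.one_lt_rpow (by norm_num) hg0
    have hac : t ^ (β / 2) < (t + s) ^ (β / 2) := Real.rpow_lt_rpow ht.le (by linarith) hg0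
    have hbc : s ^ (β / 2) < (t + s) ^ (β / 2) := Real.rpow_lt_rpow hs.le (by linarith) hg0
    have h1 := Real.rpow_add_le_add_rpow ht.le hs.le hg0.le hg1
    have hcv := Real.concaveOn_rpow hg0.le hg1
    have h2 := hcv.2 (Set.mem_Ici.2 ht.le) (Set.mem_Ici.2 hs.le)
      (by norm_num : (0 : ℝ) ≤ 1 / 2) (by norm_num : (0 : ℝ) ≤ 1 / 2) (by norm_num)
    simp only [smul_eq_mul] at h2
    rw [show 1 / 2 * t + 1 / 2 * s = (t + s) / 2 by ring,
      Real.div_rpow (by linarith) (by norm_num)] at h2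
    have hneg : (2 : ℝ) ^ (-(β / 2)) = ((2 : ℝ) ^ (β / 2))⁻¹ := Real.rpow_neg (by norm_num) _
    rw [hneg]
    unfold expKernel
    generalize t ^ (β / 2) = a at *
    generalize s ^ (β / 2) = b at *
    generalize (t + s) ^ (β / 2) = c at *
    generalize (2 : ℝ) ^ (β / 2) = k at *
    have hk0 : 0 < k := by linarith
    have hd : 0 < 1 - k⁻¹ := sub_pos.2 (inv_lt_one_of_one_lt₀ hk)
    have M := ek_main_abs x ha hb hac hbc h1 hd (by
      rw [div_eq_mul_inv c k] at h2; nlinarith)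
    have e1 : (fun y : ℝ => 1 / (2 * a) * Real.exp (-|x - y| / a)
        * (1 / (2 * b) * Real.exp (-|y| / b)))
        = fun y => (1 / (4 * a * b)) * (Real.exp (-|x - y| / a) * Real.exp (-|y| / b)) := by
      ext y; field_simp; ring
    rw [e1, integral_const_mul]
    calc _ ≤ 1 / (4 * a * b) * _ := mul_le_mul_of_nonneg_left M (by positivity)
      _ = _ := by
        rw [show -(1 - (1 - k⁻¹)) = -k⁻¹ by ring, show 1 - k⁻¹ = (k - 1) / k by field_simp]
        have : k - 1 ≠ 0 := by linarith
        field_simp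
        ring
end
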